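/- arXiv:1603.08177 — 12 statements merged into one kernel-verified Lean document; each statement's English description precedes it below -/
import Mathlib

section
/- For every planning instance with present-bias parameter b > 1 and every node u, the cost incurred by a sophisticated agent starting at u is at most b times the optimal cost: C_s(u) ≤ b · C_o(u). In particular, the sophisticated agent's cost ratio C_s(s)/C_o(s) is at most b. -/
/-- `IsPathTo E t u l`: `l` lists the successive vertices strictly after `u`
on a directed path from `u` to `t` along edges of `E`. -/
def IsPathTo {n : ℕ} (E : Fin n → Fin n → Prop) (t : Fin n) :
    Fin n → List (Fin n) → Prop
  | u, [] => u = t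
  | u, v :: l => E u v ∧ IsPathTo E t v l

/-- Total cost (or reward) of the path from `u` along the vertex list `l`. -/
def pathCost {n : ℕ} (c : Fin n → Fin n → ℝ) : Fin n → List (Fin n) → ℝ
  | _, [] => 0
  | u, v :: l => c u v + pathCost c v l

/-- A planning instance: a finite DAG on `Fin n` (the order on `Fin n` is a
topological order, which is WLOG for finite DAGs), nonnegative edge costs,
a source `s` and a target `t` that is reachable from every node. -/
structure PlanningInstance (n : ℕ) where
  E : Fin n → Fin n → Prop
  c : Fin n → Fin n → ℝ
  s : Fin n
  t : Fin n
  edge_lt : ∀ u v, E u v → u < v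
  c_nonneg : ∀ u v, E u v → 0 ≤ c u v
  reach : ∀ u, ∃ l, IsPathTo E t u l

/-- `Co u` is the minimum total cost of a directed path from `u` to the target. -/
def IsOptCost {n : ℕ} (G : PlanningInstance n) (Co : Fin n → ℝ) : Prop :=
  ∀ u, IsLeast {x : ℝ | ∃ l, IsPathTo G.E G.t u l ∧ pathCost G.c u l = x} (Co u)

/-- `S` is a sophisticated choice function with present-bias `b`, and `C` the
cost it incurs: `C t = 0`, and at each `u ≠ t` the successor `S u` minimizes
`b * c u v + C v` over edges `(u, v)`, with `C u = c u (S u) + C (S u)`. -/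
structure SophSpec {n : ℕ} (G : PlanningInstance n) (b : ℝ)
    (S : Fin n → Fin n) (C : Fin n → ℝ) : Prop where
  cost_t : C G.t = 0
  edge : ∀ u, u ≠ G.t → G.E u (S u)
  min : ∀ u, u ≠ G.t → ∀ v, G.E u v →
    b * G.c u (S u) + C (S u) ≤ b * G.c u v + C v
  cost : ∀ u, u ≠ G.t → C u = G.c u (S u) + C (S u)

theorem PlanningInstance.pathCost_nonneg {n : ℕ} (G : PlanningInstance n)
    (u : Fin n) (l : List (Fin n)) (hl : IsPathTo G.E G.t u l) :
    0 ≤ pathCost G.c u l := by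
  induction l generalizing u with
  | nil => exact le_rfl
  | cons v l ih => exact add_nonneg (G.c_nonneg u v hl.1) (ih v hl.2)

/-- The sophisticated cost is at most `b` times the cost of any path to the target. -/
theorem SophSpec.cost_le_mul_pathCost {n : ℕ} {G : PlanningInstance n} {b : ℝ}
    {S : Fin n → Fin n} {C : Fin n → ℝ} (hS : SophSpec G b S C) (hb : 1 ≤ b)
    (u : Fin n) (l : List (Fin n)) (hl : IsPathTo G.E G.t u l) :
    C u ≤ b * pathCost G.c u l := by
  induction l generalizing u with
  | nil =>
    obtain rfl : u = G.t := hl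
    simp [pathCost, hS.cost_t]
  | cons v l ih =>
    by_cases hu : u = G.t
    · rw [hu, hS.cost_t, ← hu]
      exact mul_nonneg (zero_le_one.trans hb) (G.pathCost_nonneg u _ hl)
    · calc C u = G.c u (S u) + C (S u) := hS.cost u hu
        _ ≤ b * G.c u (S u) + C (S u) := by
          gcongr
          exact le_mul_of_one_le_left (G.c_nonneg _ _ (hS.edge u hu)) hb
        _ ≤ b * G.c u v + C v := hS.min u hu v hl.1
        _ ≤ b * G.c u v + b * pathCost G.c v l := by
          gcongr
          exact ih v hl.2
        _ = b * pathCost G.c u (v :: l) := by rw [pathCost, mul_add]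

/-- In every planning instance with present-bias `b > 1`, the
cost incurred by a sophisticated agent from any node `u` is at most `b` times
the optimal cost: `C_s(u) ≤ b · C_o(u)`; in particular the cost ratio at `s`
is at most `b`. -/
theorem sophisticated_cost_ratio {n : ℕ} (G : PlanningInstance n) (b : ℝ)
    (hb : 1 < b) (Co : Fin n → ℝ) (hCo : IsOptCost G Co)
    (S : Fin n → Fin n) (Cs : Fin n → ℝ) (hS : SophSpec G b S Cs) :
    (∀ u, Cs u ≤ b * Co u) ∧ Cs G.s ≤ b * Co G.s := by
  have key : ∀ u, Cs u ≤ b * Co u := fun u => by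
    obtain ⟨l, hl, hcost⟩ := (hCo u).1
    exact hcost ▸ hS.cost_le_mul_pathCost hb.le u l hl
  exact ⟨key, key G.s⟩
end

section
/- The bound b on the sophisticated agent's cost ratio is tight: for every b > 1 and every ε > 0 there exists a planning instance (with three nodes) in which C_s(s) ≥ (b − ε) · C_o(s). Concretely, the instance with nodes s, v₁, t, edges s→v₁ of cost 0, v₁→t of cost γ, and s→t of cost 1, where 1 < γ < b, satisfies C_s(s) = γ and C_o(s) = 1. -/
/-- A potential that vanishes at `t` and is feasible on every edge bounds the cost of every
path to `t` from below. -/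
theorem le_pathCost_of_feasible {n : ℕ} {E : Fin n → Fin n → Prop} {c : Fin n → Fin n → ℝ}
    {t : Fin n} {p : Fin n → ℝ} (ht : p t = 0) (hp : ∀ u v, E u v → p u ≤ c u v + p v) :
    ∀ (l : List (Fin n)) (u : Fin n), IsPathTo E t u l → p u ≤ pathCost c u l
  | [], u, h => by
    have hu : u = t := h
    simp [pathCost, hu, ht]
  | v :: l, u, ⟨huv, h⟩ =>
    (hp u v huv).trans
      (add_le_add_right (le_pathCost_of_feasible ht hp l v h) (c u v))

/-- The three-node instance with edges `0 → 1` of cost `0`, `1 → 2` of cost `γ` and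
`0 → 2` of cost `1`. -/
def triangleInstance (γ : ℝ) (hγ : 0 ≤ γ) : PlanningInstance 3 where
  E u v := u < v
  c := ![![0, 0, 1], ![0, 0, γ], ![0, 0, 0]]
  s := 0
  t := 2
  edge_lt _ _ h := h
  c_nonneg u v _ := by fin_cases u <;> fin_cases v <;> simp [hγ]
  reach u := by
    fin_cases u
    · exact ⟨[2], by simp [IsPathTo]⟩
    · exact ⟨[2], by simp [IsPathTo]⟩
    · exact ⟨[], by simp [IsPathTo]⟩

theorem triangleInstance_isOptCost {γ : ℝ} (hγ : 1 ≤ γ) :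
    IsOptCost (triangleInstance γ (zero_le_one.trans hγ)) ![1, γ, 0] := by
  intro u
  constructor
  · fin_cases u
    · exact ⟨[2], by simp [IsPathTo, triangleInstance], by simp [pathCost, triangleInstance]⟩
    · exact ⟨[2], by simp [IsPathTo, triangleInstance], by simp [pathCost, triangleInstance]⟩
    · exact ⟨[], by simp [IsPathTo, triangleInstance], by simp [pathCost]⟩
  · rintro _ ⟨l, hl, rfl⟩
    refine le_pathCost_of_feasible (by simp [triangleInstance]) ?_ l u hl
    intro u v huv
    fin_cases u <;> fin_cases v <;> simp_all [triangleInstance]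

theorem triangleInstance_sophSpec {γ b : ℝ} (hγ : 0 ≤ γ) (hb : γ ≤ b) :
    SophSpec (triangleInstance γ hγ) b ![1, 2, 2] ![γ, γ, 0] where
  cost_t := by simp [triangleInstance]
  edge u hu := by fin_cases u <;> simp_all [triangleInstance]
  min u hu v huv := by
    fin_cases u <;> fin_cases v <;> simp_all [triangleInstance]
  cost u hu := by fin_cases u <;> simp_all [triangleInstance]

/-- The bound `b` on the sophisticated cost ratio is tight:
for every `b > 1` and `ε > 0` there is a three-node planning instance with
`C_o(s) = 1` and `C_s(s) = γ` for some `1 < γ < b`, so that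
`C_s(s) ≥ (b - ε) · C_o(s)`. -/
theorem sophisticated_cost_ratio_tight (b ε : ℝ) (hb : 1 < b) (hε : 0 < ε) :
    ∃ (G : PlanningInstance 3) (Co : Fin 3 → ℝ) (S : Fin 3 → Fin 3)
      (Cs : Fin 3 → ℝ) (γ : ℝ),
      IsOptCost G Co ∧ SophSpec G b S Cs ∧
      1 < γ ∧ γ < b ∧ Co G.s = 1 ∧ Cs G.s = γ ∧
      (b - ε) * Co G.s ≤ Cs G.s := by
  have hγ : 1 < max ((1 + b) / 2) (b - ε) := lt_max_of_lt_left (by linarith)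
  have hγb : max ((1 + b) / 2) (b - ε) < b := max_lt (by linarith) (by linarith)
  refine ⟨_, _, _, _, _, triangleInstance_isOptCost hγ.le, triangleInstance_sophSpec _ hγb.le,
    hγ, hγb, rfl, rfl, ?_⟩
  simp [triangleInstance]
end

section
/- For every b > 1 and every ε > 0 there exists a planning instance in which the cost incurred by the sophisticated agent exceeds the cost incurred by the naive agent by a factor of at least b − ε: C_s(s) ≥ (b − ε) · C_n(s). Concretely, the five-node instance with edges s→u of cost x, s→w of cost 0, u→t of cost 1, u→v of cost 0, v→t of cost b − δ, and w→t of cost bx + b − 2δ (for small δ > 0 and large x) has C_n(s) = x + b − δ and C_s(s) = bx + b − 2δ, whose ratio approaches b as x → ∞ and δ → 0. -/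
/-- `S` is a naive choice function with bias `b` (minimizing `b·c(u,v) + Co v`
over edges `(u,v)`), and `C` the cost it incurs. -/
structure NaiveSpec {n : ℕ} (G : PlanningInstance n) (b : ℝ) (Co : Fin n → ℝ)
    (S : Fin n → Fin n) (C : Fin n → ℝ) : Prop where
  cost_t : C G.t = 0
  edge : ∀ u, u ≠ G.t → G.E u (S u)
  min : ∀ u, u ≠ G.t → ∀ v, G.E u v →
    b * G.c u (S u) + Co (S u) ≤ b * G.c u v + Co v
  cost : ∀ u, u ≠ G.t → C u = G.c u (S u) + C (S u)

/-- A function that vanishes at the target and grows along each edge by at most the cost of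
that edge is a lower bound for path costs. -/
theorem le_pathCost {n : ℕ} {E : Fin n → Fin n → Prop} {c : Fin n → Fin n → ℝ} {t : Fin n}
    {f : Fin n → ℝ} (ht : f t = 0) (hf : ∀ u v, E u v → f u ≤ c u v + f v) :
    ∀ (l : List (Fin n)) (u : Fin n), IsPathTo E t u l → f u ≤ pathCost c u l
  | [], u, h => by
    obtain rfl : u = t := h
    exact ht.le
  | v :: l, u, h => (hf u v h.1).trans (add_le_add_right (le_pathCost ht hf l v h.2) _)

/-- The edges of the five-node instance, with `s, u, v, w, t` numbered `0, 1, 2, 3, 4`. -/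
def fiveNodeEdge (i j : Fin 5) : Prop :=
  (i, j) ∈ ({(0, 1), (0, 3), (1, 2), (1, 4), (2, 4), (3, 4)} : Finset (Fin 5 × Fin 5))

theorem forall_fiveNodeEdge {P : Fin 5 → Fin 5 → Prop} (h01 : P 0 1) (h03 : P 0 3)
    (h12 : P 1 2) (h14 : P 1 4) (h24 : P 2 4) (h34 : P 3 4) :
    ∀ i j, fiveNodeEdge i j → P i j := by
  intro i j h
  simp only [fiveNodeEdge, Finset.mem_insert, Finset.mem_singleton, Prod.mk.injEq] at h
  rcases h with ⟨rfl, rfl⟩ | ⟨rfl, rfl⟩ | ⟨rfl, rfl⟩ | ⟨rfl, rfl⟩ | ⟨rfl, rfl⟩ | ⟨rfl, rfl⟩ <;>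
    assumption

/-- The edge costs of the five-node instance. -/
def fiveNodeCost (b x δ : ℝ) : Fin 5 → Fin 5 → ℝ :=
  ![![0, x, 0, 0, 0], ![0, 0, 0, 0, 1], ![0, 0, 0, 0, b - δ],
    ![0, 0, 0, 0, b * x + b - 2 * δ], 0]

/-- For each node of the five-node instance, the nodes following it on a cheapest path to
the target. -/
def fiveNodeOptPath : Fin 5 → List (Fin 5) := ![[1, 4], [4], [4], [4], []]

theorem isPathTo_fiveNodeOptPath (i : Fin 5) :
    IsPathTo fiveNodeEdge 4 i (fiveNodeOptPath i) := by
  fin_cases i <;> simp [fiveNodeOptPath, IsPathTo, fiveNodeEdge]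

/-- The five-node planning instance. -/
def fiveNodeInstance (b x δ : ℝ) (hx : 0 ≤ x) (hv : 0 ≤ b - δ)
    (hw : 0 ≤ b * x + b - 2 * δ) : PlanningInstance 5 where
  E := fiveNodeEdge
  c := fiveNodeCost b x δ
  s := 0
  t := 4
  edge_lt := by apply forall_fiveNodeEdge <;> decide
  c_nonneg := by apply forall_fiveNodeEdge <;> simp [fiveNodeCost, hx, hv, hw]
  reach i := ⟨_, isPathTo_fiveNodeOptPath i⟩

section

variable {b x δ : ℝ} (hx : 0 ≤ x) (hv : 0 ≤ b - δ) (hw : 0 ≤ b * x + b - 2 * δ)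

theorem isOptCost_fiveNodeInstance (hδ : 0 < δ) (hb : 1 ≤ b - 2 * δ) :
    IsOptCost (fiveNodeInstance b x δ hx hv hw)
      ![x + 1, 1, b - δ, b * x + b - 2 * δ, 0] := by
  intro i
  refine ⟨⟨fiveNodeOptPath i, isPathTo_fiveNodeOptPath i, ?_⟩, ?_⟩
  · fin_cases i <;> simp [fiveNodeInstance, fiveNodeOptPath, fiveNodeCost, pathCost]
  · rintro _ ⟨l, hl, rfl⟩
    refine le_pathCost (t := 4) (by simp) ?_ l i hl
    have : x ≤ b * x := le_mul_of_one_le_left hx (by linarith)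
    apply forall_fiveNodeEdge <;> simp [fiveNodeInstance, fiveNodeCost] <;> linarith

theorem sophSpec_fiveNodeInstance (hδ : 0 < δ) :
    SophSpec (fiveNodeInstance b x δ hx hv hw) b ![3, 2, 4, 4, 4]
      ![b * x + b - 2 * δ, b - δ, b - δ, b * x + b - 2 * δ, 0] where
  cost_t := by simp [fiveNodeInstance]
  edge i hi := by
    fin_cases i <;> simp [fiveNodeInstance, fiveNodeEdge] at hi ⊢
  min i _ := by
    revert i
    suffices ∀ i j, fiveNodeEdge i j → _ from fun i _ j => this i j
    apply forall_fiveNodeEdge <;> simp [fiveNodeInstance, fiveNodeCost] <;> linarith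
  cost i hi := by
    fin_cases i <;> simp [fiveNodeInstance, fiveNodeCost] at hi ⊢

theorem naiveSpec_fiveNodeInstance (hδ : 0 < δ) (hb : 1 ≤ b - 2 * δ) :
    NaiveSpec (fiveNodeInstance b x δ hx hv hw) b
      ![x + 1, 1, b - δ, b * x + b - 2 * δ, 0] ![1, 2, 4, 4, 4]
      ![x + b - δ, b - δ, b - δ, b * x + b - 2 * δ, 0] where
  cost_t := by simp [fiveNodeInstance]
  edge i hi := by
    fin_cases i <;> simp [fiveNodeInstance, fiveNodeEdge] at hi ⊢
  min i _ := by
    revert i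
    suffices ∀ i j, fiveNodeEdge i j → _ from fun i _ j => this i j
    apply forall_fiveNodeEdge <;> simp [fiveNodeInstance, fiveNodeCost] <;> linarith
  cost i hi := by
    fin_cases i <;> simp [fiveNodeInstance, fiveNodeCost, add_sub_assoc] at hi ⊢

end

/-- A sophisticated agent can incur cost exceeding that of a
naive agent by a factor arbitrarily close to `b`: for every `b > 1` and
`ε > 0` there is a five-node instance with `C_n(s) = x + b - δ` and
`C_s(s) = b·x + b - 2δ`, so that `C_s(s) ≥ (b - ε) · C_n(s)`. -/
theorem sophisticated_vs_naive (b ε : ℝ) (hb : 1 < b) (hε : 0 < ε) :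
    ∃ (G : PlanningInstance 5) (Co Cs Cn : Fin 5 → ℝ)
      (Ss Sn : Fin 5 → Fin 5) (x δ : ℝ),
      IsOptCost G Co ∧ SophSpec G b Ss Cs ∧ NaiveSpec G b Co Sn Cn ∧
      0 < δ ∧ 1 ≤ x ∧
      Cn G.s = x + b - δ ∧ Cs G.s = b * x + b - 2 * δ ∧
      (b - ε) * Cn G.s ≤ Cs G.s := by
  obtain ⟨δ, hδ, hbδ⟩ : ∃ δ : ℝ, 0 < δ ∧ 1 ≤ b - 2 * δ :=
    ⟨(b - 1) / 2, by linarith, by linarith⟩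
  obtain ⟨x, hx1, hx⟩ : ∃ x : ℝ, 1 ≤ x ∧ b ^ 2 ≤ ε * x :=
    ⟨max 1 (b ^ 2 / ε), le_max_left _ _, (div_le_iff₀' hε).1 (le_max_right _ _)⟩
  have hx0 : 0 ≤ x := by linarith
  have hv : 0 ≤ b - δ := by linarith
  have hw : 0 ≤ b * x + b - 2 * δ := by
    have : 0 ≤ b * x := by positivity
    linarith
  refine ⟨fiveNodeInstance b x δ hx0 hv hw, _, _, _, _, _, x, δ,
    isOptCost_fiveNodeInstance hx0 hv hw hδ hbδ, sophSpec_fiveNodeInstance hx0 hv hw hδ,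
    naiveSpec_fiveNodeInstance hx0 hv hw hδ hbδ, hδ, hx1, rfl, rfl, ?_⟩
  change (b - ε) * (x + b - δ) ≤ b * x + b - 2 * δ
  have hbd : 0 ≤ b * δ := by positivity
  have hεv : 0 ≤ ε * (b - δ) := by positivity
  linarith
end

section
/- In every planning instance with present-bias parameter b > 1, the cost incurred by the sophisticated agent is at most b times the cost incurred by the naive agent: C_s(s) ≤ b · C_n(s). -/
/-- The sophisticated agent, anticipating its own future behaviour, incurs at most `b` times the
cost of following any fixed policy `S`. -/
theorem SophSpec.cost_le_mul {n : ℕ} {G : PlanningInstance n} {b : ℝ} (hb : 1 ≤ b)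
    {Ss : Fin n → Fin n} {Cs : Fin n → ℝ} (hS : SophSpec G b Ss Cs)
    {S : Fin n → Fin n} {C : Fin n → ℝ} (ht : C G.t = 0)
    (edge : ∀ u, u ≠ G.t → G.E u (S u))
    (cost : ∀ u, u ≠ G.t → C u = G.c u (S u) + C (S u)) (u : Fin n) :
    Cs u ≤ b * C u := by
  induction u using WellFoundedGT.induction with
  | ind u ih =>
    by_cases hu : u = G.t
    · simp [hu, hS.cost_t, ht]
    · have hnext := ih (S u) (G.edge_lt u (S u) (edge u hu))
      have hmin := hS.min u hu (S u) (edge u hu)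
      have hle : G.c u (Ss u) ≤ b * G.c u (Ss u) :=
        le_mul_of_one_le_left (G.c_nonneg u (Ss u) (hS.edge u hu)) hb
      rw [hS.cost u hu, cost u hu, mul_add]
      linarith

/-- In every planning instance with bias `b > 1`, the cost
incurred by the sophisticated agent is at most `b` times the cost incurred by
the naive agent: `C_s(s) ≤ b · C_n(s)`. -/
theorem sophisticated_at_most_b_times_naive {n : ℕ} (G : PlanningInstance n)
    (b : ℝ) (hb : 1 < b) (Co : Fin n → ℝ) (hCo : IsOptCost G Co)
    (Ss : Fin n → Fin n) (Cs : Fin n → ℝ) (hS : SophSpec G b Ss Cs)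
    (Sn : Fin n → Fin n) (Cn : Fin n → ℝ) (hN : NaiveSpec G b Co Sn Cn) :
    Cs G.s ≤ b * Cn G.s := by
  exact hS.cost_le_mul hb.le hN.cost_t hN.edge hN.cost G.s
end

section
/- The path traversed by a sophisticated agent is not monotone in the bias parameter b: there exists a planning instance and parameters b₁ < b₂ < b₃ such that the sophisticated agent's path for bias b₁ coincides with its path for bias b₃ but differs from its path for bias b₂. Concretely, in the five-node instance with edges s→u of cost 3, s→v of cost 1, u→t of cost 2, v→w of cost 0, v→t of cost 5, and w→t of cost 49, the sophisticated agent traverses s→u→t for b = 1 and for b = 10, but traverses s→v→t for b = 2. -/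
/-- The path traversed by iterating the choice function `S` from a node to `t`. -/
inductive Traverse {n : ℕ} (G : PlanningInstance n) (S : Fin n → Fin n) :
    Fin n → List (Fin n) → Prop
  | nil : Traverse G S G.t []
  | cons {u : Fin n} {l : List (Fin n)} (h : u ≠ G.t)
      (ht : Traverse G S (S u) l) : Traverse G S u (S u :: l)

/-- The five-node planning instance on which the path of the sophisticated agent
is not monotone in the bias. -/
def nonmonotoneInstance : PlanningInstance 5 where
  E p q := (p = 0 ∧ q = 1) ∨ (p = 0 ∧ q = 2) ∨ (p = 1 ∧ q = 4) ∨
    (p = 2 ∧ q = 3) ∨ (p = 2 ∧ q = 4) ∨ (p = 3 ∧ q = 4)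
  c := ![![0, 3, 1, 0, 0], ![0, 0, 0, 0, 2], ![0, 0, 0, 0, 5], ![0, 0, 0, 0, 49],
    ![0, 0, 0, 0, 0]]
  s := 0
  t := 4
  edge_lt := by decide
  c_nonneg := by
    rintro u v (⟨rfl, rfl⟩ | ⟨rfl, rfl⟩ | ⟨rfl, rfl⟩ | ⟨rfl, rfl⟩ | ⟨rfl, rfl⟩ | ⟨rfl, rfl⟩) <;>
      simp
  reach u := by
    fin_cases u
    exacts [⟨[1, 4], by simp [IsPathTo]⟩, ⟨[4], by simp [IsPathTo]⟩, ⟨[4], by simp [IsPathTo]⟩,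
      ⟨[4], by simp [IsPathTo]⟩, ⟨[], by simp [IsPathTo]⟩]

theorem sophSpec_nonmonotoneInstance_one :
    SophSpec nonmonotoneInstance 1 ![1, 4, 4, 4, 4] ![5, 2, 5, 49, 0] where
  cost_t := by simp [nonmonotoneInstance]
  edge := by simp only [nonmonotoneInstance]; decide
  min := by
    rintro u - v
      (⟨rfl, rfl⟩ | ⟨rfl, rfl⟩ | ⟨rfl, rfl⟩ | ⟨rfl, rfl⟩ | ⟨rfl, rfl⟩ | ⟨rfl, rfl⟩) <;>
      simp [nonmonotoneInstance] <;> norm_num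
  cost u hu := by
    fin_cases u <;> simp [nonmonotoneInstance] at hu ⊢ <;> norm_num

theorem sophSpec_nonmonotoneInstance_two :
    SophSpec nonmonotoneInstance 2 ![2, 4, 4, 4, 4] ![6, 2, 5, 49, 0] where
  cost_t := by simp [nonmonotoneInstance]
  edge := by simp only [nonmonotoneInstance]; decide
  min := by
    rintro u - v
      (⟨rfl, rfl⟩ | ⟨rfl, rfl⟩ | ⟨rfl, rfl⟩ | ⟨rfl, rfl⟩ | ⟨rfl, rfl⟩ | ⟨rfl, rfl⟩) <;>
      simp [nonmonotoneInstance] <;> norm_num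
  cost u hu := by
    fin_cases u <;> simp [nonmonotoneInstance] at hu ⊢ <;> norm_num

theorem sophSpec_nonmonotoneInstance_ten :
    SophSpec nonmonotoneInstance 10 ![1, 4, 3, 4, 4] ![5, 2, 49, 49, 0] where
  cost_t := by simp [nonmonotoneInstance]
  edge := by simp only [nonmonotoneInstance]; decide
  min := by
    rintro u - v
      (⟨rfl, rfl⟩ | ⟨rfl, rfl⟩ | ⟨rfl, rfl⟩ | ⟨rfl, rfl⟩ | ⟨rfl, rfl⟩ | ⟨rfl, rfl⟩) <;>
      simp [nonmonotoneInstance] <;> norm_num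
  cost u hu := by
    fin_cases u <;> simp [nonmonotoneInstance] at hu ⊢ <;> norm_num

theorem Traverse.of_two_steps {n : ℕ} {G : PlanningInstance n} {S : Fin n → Fin n}
    {u v : Fin n} (hu : u ≠ G.t) (huv : S u = v) (hv : v ≠ G.t) (hvt : S v = G.t) :
    Traverse G S u [v, G.t] := by
  subst huv
  have h : Traverse G S (S (S u)) [] := hvt ▸ .nil
  rw [← hvt]
  exact .cons hu (.cons hv h)

/-- The sophisticated agent's path is not monotone in the
bias: there is a five-node instance (with `s = 0`, `u = 1`, `v = 2`, `w = 3`,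
`t = 4` and the costs drawn in the paper) and biases `1 < 2 < 10` such that
the traversed path for bias `1` equals the path `s → u → t` traversed for
bias `10`, while for bias `2` the agent traverses the different path
`s → v → t`. -/
theorem soph_path_not_monotone_in_bias :
    ∃ (G : PlanningInstance 5) (S₁ S₂ S₃ : Fin 5 → Fin 5)
      (C₁ C₂ C₃ : Fin 5 → ℝ) (l₁ l₂ l₃ : List (Fin 5)),
      G.s = 0 ∧ G.t = 4 ∧
      (∀ p q : Fin 5, G.E p q ↔
        ((p = 0 ∧ q = 1) ∨ (p = 0 ∧ q = 2) ∨ (p = 1 ∧ q = 4) ∨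
         (p = 2 ∧ q = 3) ∨ (p = 2 ∧ q = 4) ∨ (p = 3 ∧ q = 4))) ∧
      G.c 0 1 = 3 ∧ G.c 0 2 = 1 ∧ G.c 1 4 = 2 ∧
      G.c 2 3 = 0 ∧ G.c 2 4 = 5 ∧ G.c 3 4 = 49 ∧
      SophSpec G 1 S₁ C₁ ∧ SophSpec G 2 S₂ C₂ ∧ SophSpec G 10 S₃ C₃ ∧
      Traverse G S₁ G.s l₁ ∧ Traverse G S₂ G.s l₂ ∧ Traverse G S₃ G.s l₃ ∧
      l₁ = [1, 4] ∧ l₂ = [2, 4] ∧ l₃ = l₁ ∧ l₁ ≠ l₂ := by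
  refine ⟨nonmonotoneInstance, _, _, _, _, _, _, [1, 4], [2, 4], [1, 4], rfl, rfl,
    fun _ _ => Iff.rfl, rfl, rfl, rfl, rfl, rfl, rfl, sophSpec_nonmonotoneInstance_one,
    sophSpec_nonmonotoneInstance_two, sophSpec_nonmonotoneInstance_ten, ?_, ?_, ?_,
    rfl, rfl, rfl, by decide⟩ <;>
  exact .of_two_steps (by simp [nonmonotoneInstance]) rfl (by simp [nonmonotoneInstance]) rfl
end

section
/- The factor b between R^min and the deletion-optimal reward R_d is tight: for every b > 1 and every δ > 0 there exists a planning instance G with R^min(G) ≥ (b − δ) · R_d(G), where R_d(G) is the minimum over subgraphs G' of G (containing s and t) of R^min(G'). -/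
/-- Motivated set `M` and pruned sophisticated cost `C`, for bias `b` and a
reward `R` placed at the target, over the edge relation `E'`: `t` is motivated
with `C t = 0`; a node `u ≠ t` is motivated iff some edge `(u,v)` has `v`
motivated and perceived cost `b·c(u,v) + C v ≤ R`, in which case `C u` follows
a minimizer of `b·c(u,v) + C v` over such edges. -/
structure RewardSpecOn {n : ℕ} (G : PlanningInstance n)
    (E' : Fin n → Fin n → Prop) (b R : ℝ)
    (M : Fin n → Prop) (C : Fin n → ℝ) : Prop where
  m_t : M G.t
  c_t : C G.t = 0
  m_iff : ∀ u, u ≠ G.t →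
    (M u ↔ ∃ v, E' u v ∧ M v ∧ b * G.c u v + C v ≤ R)
  c_min : ∀ u, u ≠ G.t → M u →
    ∃ v, E' u v ∧ M v ∧ b * G.c u v + C v ≤ R ∧ C u = G.c u v + C v ∧
      (∀ w, E' u w → M w → b * G.c u w + C w ≤ R →
        b * G.c u v + C v ≤ b * G.c u w + C w)

/-- The graph, restricted to the edges `E'`, is traversable for reward `R`:
the source is motivated. -/
def TraversableOn {n : ℕ} (G : PlanningInstance n)
    (E' : Fin n → Fin n → Prop) (b R : ℝ) : Prop :=
  ∃ M C, RewardSpecOn G E' b R M C ∧ M G.s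

/-- `R^min(G)`: the minimal (nonnegative) reward at `t` for which `G` is
traversable by the sophisticated agent. -/
noncomputable def Rmin {n : ℕ} (G : PlanningInstance n) (b : ℝ) : ℝ :=
  sInf {R : ℝ | 0 ≤ R ∧ TraversableOn G G.E b R}

/-- `R_d(G)`: the minimal reward for which some subgraph of `G` is traversable
(i.e. the minimum of `R^min` over subgraphs obtained by deleting edges). -/
noncomputable def Rdel {n : ℕ} (G : PlanningInstance n) (b : ℝ) : ℝ :=
  sInf {R : ℝ | 0 ≤ R ∧ ∃ E' : Fin n → Fin n → Prop,
    (∀ u v, E' u v → G.E u v) ∧ TraversableOn G E' b R}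

namespace RewardSpecOn

variable {n : ℕ} {G : PlanningInstance n} {E' : Fin n → Fin n → Prop} {b R : ℝ}
  {M : Fin n → Prop} {C : Fin n → ℝ}

/-- The pruned sophisticated cost of a motivated node is nonnegative. -/
theorem cost_nonneg (h : RewardSpecOn G E' b R M C) (hE : ∀ u v, E' u v → G.E u v)
    (u : Fin n) (hu : M u) : 0 ≤ C u := by
  induction u using WellFoundedGT.induction with
  | ind u ih =>
    by_cases hut : u = G.t
    · rw [hut, h.c_t]
    · obtain ⟨v, huv, hv, -, hC, -⟩ := h.c_min u hut hu
      have := ih v (G.edge_lt u v (hE u v huv)) hv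
      have := G.c_nonneg u v (hE u v huv)
      linarith

/-- A motivated node other than the target has pruned sophisticated cost at most the reward. -/
theorem cost_le_reward (h : RewardSpecOn G E' b R M C) (hE : ∀ u v, E' u v → G.E u v)
    (hb : 1 ≤ b) {u : Fin n} (hut : u ≠ G.t) (hu : M u) : C u ≤ R := by
  obtain ⟨v, huv, -, hR, hC, -⟩ := h.c_min u hut hu
  have := le_mul_of_one_le_left (G.c_nonneg u v (hE u v huv)) hb
  linarith

end RewardSpecOn

/-- Edges of the procrastination graph on `{0, …, N + N² + 1}`. The nodes `0, …, N` form the work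
path, the nodes `N + 1, …, N + N² + 1` form the shirking path, and every node `x ≤ N` also has an
edge to the node of the shirking path that is `N * (N - x)` steps away from its end. -/
def ProcrastinationEdge (N x y : ℕ) : Prop :=
  (y = x + 1 ∧ y ≤ N) ∨ (x ≤ N ∧ y = N + 1 + N * x) ∨ (N < x ∧ y = x + 1)

/-- Edge costs of the procrastination graph: `N + b - 1` on the work path, `b` on the shirking path,
and `0` for switching from the former to the latter. -/
noncomputable def procrastinationCost (N : ℕ) (b : ℝ) (x y : ℕ) : ℝ :=
  if x ≤ N then (if y ≤ N then N + b - 1 else 0) else b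

/-- The cost incurred on the procrastination graph by a sophisticated agent with a large reward. -/
noncomputable def procrastinationValue (N : ℕ) (b : ℝ) (x : ℕ) : ℝ :=
  if x ≤ N then b * (N * (N - x)) else b * (N + N * N + 1 - x)

theorem exists_procrastinationEdge {N x : ℕ} (hx : x < N + N * N + 1) :
    ∃ y < N + N * N + 2, ProcrastinationEdge N x y := by
  rcases le_or_gt x N with h | h
  · refine ⟨N + 1 + N * x, ?_, Or.inr (Or.inl ⟨h, rfl⟩)⟩
    have := Nat.mul_le_mul_left N h
    omega
  · exact ⟨x + 1, by omega, Or.inr (Or.inr ⟨h, rfl⟩)⟩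

theorem ProcrastinationEdge.lt {N x y : ℕ} (h : ProcrastinationEdge N x y) : x < y := by
  rcases h with h | h | h
  · omega
  · have := Nat.zero_le (N * x)
    omega
  · omega

/-- The procrastination graph as a planning instance. -/
noncomputable def procrastination (N : ℕ) (b : ℝ) (hb : 1 < b) :
    PlanningInstance (N + N * N + 2) where
  E x y := ProcrastinationEdge N x y
  c x y := procrastinationCost N b x y
  s := ⟨0, by omega⟩
  t := ⟨N + N * N + 1, by omega⟩
  edge_lt _ _ h := h.lt
  c_nonneg x y _ := by
    have : (0 : ℝ) ≤ N := N.cast_nonneg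
    unfold procrastinationCost
    split_ifs <;> linarith
  reach u := by
    induction u using WellFoundedGT.induction with
    | ind u ih =>
      by_cases hu : u.val = N + N * N + 1
      · exact ⟨[], Fin.ext hu⟩
      · obtain ⟨y, hy, hE⟩ := exists_procrastinationEdge (N := N) (x := u.val) (by omega)
        obtain ⟨l, hl⟩ := ih ⟨y, hy⟩ hE.lt
        exact ⟨⟨y, hy⟩ :: l, hE, hl⟩

section

variable {N : ℕ} {b R : ℝ} {hb : 1 < b}
  {M : Fin (N + N * N + 2) → Prop} {C : Fin (N + N * N + 2) → ℝ}

theorem procrastination_ne_t {u : Fin (N + N * N + 2)} (hu : u.val < N + N * N + 1) :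
    u ≠ (procrastination N b hb).t := by
  intro h
  have : u.val = N + N * N + 1 := congrArg Fin.val h
  omega

theorem procrastination_val_lt {u : Fin (N + N * N + 2)} (hu : u ≠ (procrastination N b hb).t) :
    u.val < N + N * N + 1 := by
  have : u.val ≠ N + N * N + 1 := fun h => hu (Fin.ext h)
  omega

/-- A motivated node of the shirking path has cost `b` times the number of remaining edges. -/
theorem procrastination_shirking_cost
    (h : RewardSpecOn (procrastination N b hb) (procrastination N b hb).E b R M C)
    (u : Fin (N + N * N + 2)) (huN : N < u.val) (hu : M u) :
    C u = b * (N + N * N + 1 - u.val) := by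
  induction u using WellFoundedGT.induction with
  | ind u ih =>
    by_cases hut : u = (procrastination N b hb).t
    · subst hut
      rw [h.c_t]
      simp [procrastination]
    · obtain ⟨v, huv, hv, -, hC, -⟩ := h.c_min u hut hu
      have hlt := huv.lt
      have hv1 : v.val = u.val + 1 := by
        rcases huv with h' | h' | h' <;> omega
      rw [hC, ih v hlt (by omega) hv, hv1]
      simp only [procrastination, procrastinationCost, if_neg huN.not_ge]
      push_cast
      ring

/-- A node of the shirking path is motivated by a reward exceeding its cost by `b * (b - 1)`. -/
theorem procrastination_shirking_motivated
    (h : RewardSpecOn (procrastination N b hb) (procrastination N b hb).E b R M C)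
    (u : Fin (N + N * N + 2)) (huN : N < u.val)
    (hR : b * (N + N * N + 1 - u.val) + b * (b - 1) ≤ R) : M u := by
  induction u using WellFoundedGT.induction with
  | ind u ih =>
    by_cases hut : u = (procrastination N b hb).t
    · subst hut
      exact h.m_t
    · have hlt := procrastination_val_lt hut
      set v : Fin (N + N * N + 2) := ⟨u.val + 1, by omega⟩ with hv
      have hvM : M v := by
        refine ih v (Fin.lt_def.2 (Nat.lt_succ_self _)) (by simp only [hv]; omega) ?_
        simp only [hv]
        push_cast
        nlinarith
      refine (h.m_iff u hut).2 ⟨v, Or.inr (Or.inr ⟨huN, rfl⟩), hvM, ?_⟩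
      rw [procrastination_shirking_cost h v (by simp only [hv]; omega) hvM]
      simp only [procrastination, procrastinationCost, if_neg huN.not_ge, hv]
      push_cast
      linarith

/-- A motivated node of the work path incurs at least the cost of shirking. -/
theorem le_procrastination_work_cost
    (h : RewardSpecOn (procrastination N b hb) (procrastination N b hb).E b R M C)
    (u : Fin (N + N * N + 2)) (huN : u.val ≤ N) (hu : M u) :
    b * (N * (N - u.val)) ≤ C u := by
  induction u using WellFoundedGT.induction with
  | ind u ih =>
    have hut : u ≠ (procrastination N b hb).t := procrastination_ne_t (by nlinarith)
    have hle := Nat.mul_le_mul_left N huN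
    have hpos := Nat.zero_le (N * u.val)
    obtain ⟨v, huv, hv, hR, hC, hmin⟩ := h.c_min u hut hu
    rcases le_or_gt v.val N with hvN | hvN
    · have hv1 : v.val = u.val + 1 := by
        rcases huv with h' | h' | h' <;> omega
      have hCv := ih v huv.lt hvN hv
      have hc : (procrastination N b hb).c u v = N + b - 1 := by
        simp [procrastination, procrastinationCost, huN, hvN]
      rw [hc] at hR hmin
      rw [hv1] at hCv
      push_cast at hCv
      set w : Fin (N + N * N + 2) := ⟨N + 1 + N * u.val, by omega⟩ with hw
      have hwN : N < w.val := by simp only [hw]; omega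
      have hwval : (w.val : ℝ) = N + 1 + N * u.val := by simp only [hw]; push_cast; rfl
      have hwM : M w := by
        refine procrastination_shirking_motivated h w hwN ?_
        rw [hwval]
        nlinarith
      have hCw := procrastination_shirking_cost h w hwN hwM
      have hcw : (procrastination N b hb).c u w = 0 := by
        simp [procrastination, procrastinationCost, huN, hwN]
      rw [hwval] at hCw
      have hkey := hmin w (Or.inr (Or.inl ⟨huN, rfl⟩)) hwM (by rw [hcw, hCw]; nlinarith)
      rw [hcw, hCw] at hkey
      nlinarith
    · have hv1 : v.val = N + 1 + N * u.val := by
        rcases huv with h' | h' | h' <;> omega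
      rw [hC, procrastination_shirking_cost h v hvN hv, hv1]
      simp only [procrastination, procrastinationCost, if_pos huN, if_neg hvN.not_ge]
      push_cast
      nlinarith

end

theorem procrastinationValue_le {N : ℕ} {b : ℝ} (hb : 1 < b) (x : ℕ) :
    procrastinationValue N b x ≤ b * (N + N * N + 1) := by
  have h1 : (0 : ℝ) ≤ N := N.cast_nonneg
  have h2 : (0 : ℝ) ≤ x := x.cast_nonneg
  unfold procrastinationValue
  split_ifs
  · exact mul_le_mul_of_nonneg_left (by nlinarith) (by linarith)
  · exact mul_le_mul_of_nonneg_left (by linarith) (by linarith)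

/-- With a sufficiently large reward the agent traverses the procrastination graph by shirking. -/
theorem procrastination_traversable (N : ℕ) {b : ℝ} (hb : 1 < b) :
    TraversableOn (procrastination N b hb) (procrastination N b hb).E b
      (b * b + b * (N + N * N + 1)) := by
  have hbb : 0 ≤ b * b := by positivity
  have hmin : ∀ u, u ≠ (procrastination N b hb).t → ∃ v, (procrastination N b hb).E u v ∧ True ∧
      b * (procrastination N b hb).c u v + procrastinationValue N b v ≤
        b * b + b * (N + N * N + 1) ∧
      procrastinationValue N b u =
        (procrastination N b hb).c u v + procrastinationValue N b v ∧
      (∀ w, (procrastination N b hb).E u w → True →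
        b * (procrastination N b hb).c u w + procrastinationValue N b w ≤
          b * b + b * (N + N * N + 1) →
        b * (procrastination N b hb).c u v + procrastinationValue N b v ≤
          b * (procrastination N b hb).c u w + procrastinationValue N b w) := by
    intro u hut
    have hlt := procrastination_val_lt hut
    have hpos := Nat.zero_le (N * u.val)
    rcases le_or_gt u.val N with huN | huN
    · have hle := Nat.mul_le_mul_left N huN
      set v : Fin (N + N * N + 2) := ⟨N + 1 + N * u.val, by omega⟩ with hv
      have hvN : ¬ v.val ≤ N := by simp only [hv]; omega
      have hc : (procrastination N b hb).c u v = 0 := by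
        simp only [procrastination, procrastinationCost, if_pos huN, if_neg hvN]
      have hval : procrastinationValue N b v = b * (N * (N - u.val)) := by
        simp only [procrastinationValue, if_neg hvN]
        simp only [hv]
        push_cast
        ring
      refine ⟨v, Or.inr (Or.inl ⟨huN, rfl⟩), trivial, ?_, ?_, ?_⟩
      · have := procrastinationValue_le (N := N) hb v
        rw [hc]
        linarith
      · rw [hc, hval, procrastinationValue, if_pos huN, zero_add]
      · intro w huw _ _
        rcases le_or_gt w.val N with hwN | hwN
        · have hw1 : w.val = u.val + 1 := by
            rcases huw with h' | h' | h' <;> omega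
          rw [hc, hval]
          simp only [procrastination, procrastinationCost, if_pos huN, if_pos hwN,
            procrastinationValue]
          rw [hw1]
          push_cast
          nlinarith
        · have hw1 : w = v := Fin.ext (by
            rcases huw with h' | h' | h'
            · omega
            · exact h'.2
            · omega)
          rw [hw1]
    · set v : Fin (N + N * N + 2) := ⟨u.val + 1, by omega⟩ with hv
      have hvN : ¬ v.val ≤ N := by simp only [hv]; omega
      have hc : (procrastination N b hb).c u v = b := by
        simp only [procrastination, procrastinationCost, if_neg huN.not_ge]
      refine ⟨v, Or.inr (Or.inr ⟨huN, rfl⟩), trivial, ?_, ?_, ?_⟩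
      · have := procrastinationValue_le (N := N) hb v
        rw [hc]
        linarith
      · rw [hc]
        simp only [procrastinationValue, if_neg hvN, if_neg huN.not_ge]
        simp only [hv]
        push_cast
        ring
      · intro w huw _ _
        have hw1 : w = v := Fin.ext (by
          rcases huw with h' | h' | h'
          · omega
          · omega
          · exact h'.2)
        rw [hw1]
  refine ⟨fun _ => True, fun x => procrastinationValue N b x, ⟨trivial, ?_, ?_, ?_⟩, trivial⟩
  · simp [procrastination, procrastinationValue]
  · intro u hut
    obtain ⟨v, huv, hv, hR, -⟩ := hmin u hut
    exact ⟨fun _ => ⟨v, huv, hv, hR⟩, fun _ => trivial⟩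
  · exact fun u hut _ => hmin u hut

/-- Deleting all shortcuts into the shirking path except the last one makes the procrastination
graph traversable for a reward close to the cost of the work path. -/
theorem procrastination_exists_subgraph_traversable (N : ℕ) {b : ℝ} (hb : 1 < b) :
    ∃ E' : Fin (N + N * N + 2) → Fin (N + N * N + 2) → Prop,
      (∀ u v, E' u v → (procrastination N b hb).E u v) ∧
      TraversableOn (procrastination N b hb) E' b ((N + b - 1) * (N + b - 1)) := by
  have hN : (0 : ℝ) ≤ N := N.cast_nonneg
  let E' : Fin (N + N * N + 2) → Fin (N + N * N + 2) → Prop := fun x y =>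
    (y.val = x.val + 1 ∧ y.val ≤ N) ∨ (x.val = N ∧ y.val = N + N * N + 1)
  let M : Fin (N + N * N + 2) → Prop := fun x => x.val ≤ N ∨ x.val = N + N * N + 1
  let C : Fin (N + N * N + 2) → ℝ := fun x =>
    if x.val ≤ N then (N + b - 1) * (N - x.val) else 0
  have hmin : ∀ u, u ≠ (procrastination N b hb).t → M u → ∃ v, E' u v ∧ M v ∧
      b * (procrastination N b hb).c u v + C v ≤ (N + b - 1) * (N + b - 1) ∧
      C u = (procrastination N b hb).c u v + C v ∧
      (∀ w, E' u w → M w →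
        b * (procrastination N b hb).c u w + C w ≤ (N + b - 1) * (N + b - 1) →
        b * (procrastination N b hb).c u v + C v ≤
          b * (procrastination N b hb).c u w + C w) := by
    intro u hut hu
    have hlt := procrastination_val_lt hut
    have huN : u.val ≤ N := by rcases hu with h | h <;> omega
    rcases huN.lt_or_eq with huN' | huN'
    · set v : Fin (N + N * N + 2) := ⟨u.val + 1, by omega⟩ with hv
      have hvN : v.val ≤ N := huN'
      have hc : (procrastination N b hb).c u v = N + b - 1 := by
        simp only [procrastination, procrastinationCost, if_pos huN, if_pos hvN]
      have hCv : C v = (N + b - 1) * (N - u.val - 1) := by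
        simp only [C, if_pos hvN]
        simp only [hv]
        push_cast
        ring
      refine ⟨v, Or.inl ⟨rfl, hvN⟩, Or.inl hvN, ?_, ?_, ?_⟩
      · have h0 : (0 : ℝ) ≤ u.val := Nat.cast_nonneg _
        rw [hc, hCv]
        nlinarith
      · rw [hc, hCv]
        simp only [C, if_pos huN]
        ring
      · intro w huw _ _
        have hw1 : w = v := Fin.ext (by
          rcases huw with h' | h'
          · exact h'.1
          · omega)
        rw [hw1]
    · set v : Fin (N + N * N + 2) := ⟨N + N * N + 1, by omega⟩ with hv
      have hvN : ¬ v.val ≤ N := by simp only [hv]; omega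
      have hc : (procrastination N b hb).c u v = 0 := by
        simp only [procrastination, procrastinationCost, if_pos huN, if_neg hvN]
      have hCv : C v = 0 := if_neg hvN
      refine ⟨v, Or.inr ⟨huN', rfl⟩, Or.inr rfl, ?_, ?_, ?_⟩
      · rw [hc, hCv]
        nlinarith
      · rw [hc, hCv]
        simp only [C, if_pos huN]
        rw [huN']
        ring
      · intro w huw _ _
        have hw1 : w = v := Fin.ext (by
          rcases huw with h' | h'
          · omega
          · exact h'.2)
        rw [hw1]
  refine ⟨E', ?_, M, C, ⟨Or.inr rfl, ?_, ?_, hmin⟩, Or.inl (Nat.zero_le N)⟩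
  · rintro u v (h | h)
    · exact Or.inl h
    · refine Or.inr (Or.inl ⟨h.1.le, ?_⟩)
      rw [h.1, h.2]
      ring
  · refine if_neg ?_
    simp only [procrastination]
    omega
  · intro u hut
    constructor
    · intro hu
      obtain ⟨v, huv, hv, hR, -⟩ := hmin u hut hu
      exact ⟨v, huv, hv, hR⟩
    · rintro ⟨v, h | h, -⟩
      · exact Or.inl (by omega)
      · exact Or.inl h.1.le

theorem le_Rmin_procrastination {N : ℕ} {b : ℝ} (hb : 1 < b) :
    b * (N * N) ≤ Rmin (procrastination N b hb) b := by
  refine le_csInf ⟨_, by positivity, procrastination_traversable N hb⟩ ?_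
  rintro R ⟨-, M, C, h, hs⟩
  have h1 := le_procrastination_work_cost h _ (Nat.zero_le N) hs
  have h2 := h.cost_le_reward (fun _ _ h => h) hb.le
    (procrastination_ne_t (Nat.succ_pos (N + N * N))) hs
  have h3 : (((procrastination N b hb).s.val : ℕ) : ℝ) = 0 := Nat.cast_zero
  rw [h3, sub_zero] at h1
  exact h1.trans h2

theorem Rdel_procrastination_le {N : ℕ} {b : ℝ} (hb : 1 < b) :
    Rdel (procrastination N b hb) b ≤ (N + b - 1) * (N + b - 1) :=
  csInf_le ⟨0, fun _ h => h.1⟩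
    ⟨mul_self_nonneg _, procrastination_exists_subgraph_traversable N hb⟩

theorem Rdel_procrastination_pos {N : ℕ} {b : ℝ} (hb : 1 < b) (hN : 0 < N) :
    0 < Rdel (procrastination N b hb) b := by
  have hN' : (1 : ℝ) ≤ N := Nat.one_le_cast.2 hN
  refine lt_of_lt_of_le (by linarith : 0 < b) (le_csInf
    ⟨_, mul_self_nonneg _, procrastination_exists_subgraph_traversable N hb⟩ ?_)
  rintro R ⟨-, E', hE, M, C, h, hs⟩
  obtain ⟨v, huv, hv, hR, -⟩ :=
    h.c_min _ (procrastination_ne_t (Nat.succ_pos (N + N * N))) hs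
  rcases le_or_gt v.val N with hvN | hvN
  · have hCv := h.cost_nonneg hE v hv
    have hc : (procrastination N b hb).c (procrastination N b hb).s v = N + b - 1 := by
      simp [procrastination, procrastinationCost, hvN]
    rw [hc] at hR
    nlinarith
  · have hc : (procrastination N b hb).c (procrastination N b hb).s v = 0 := by
      simp [procrastination, procrastinationCost, hvN]
    have hv1 : v.val = N + 1 := by
      have h0 : (procrastination N b hb).s.val = 0 := rfl
      rcases hE _ _ huv with h' | h' | h'
      · omega
      · simpa [h0] using h'.2
      · omega
    have hvt : v ≠ (procrastination N b hb).t := procrastination_ne_t (by nlinarith)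
    obtain ⟨w, hvw, hw, -, hC, -⟩ := h.c_min v hvt hv
    have hCw := h.cost_nonneg hE w hw
    have hcw : (procrastination N b hb).c v w = b := by
      simp [procrastination, procrastinationCost, hvN]
    rw [hc] at hR
    linarith

/-- The tightness of the factor `b` is witnessed by instances with positive `R_d`. -/
theorem exists_planningInstance_Rdel_pos (b δ : ℝ) (hb : 1 < b) (hδ : 0 < δ) :
    ∃ (n : ℕ) (G : PlanningInstance n), 0 < Rdel G b ∧ (b - δ) * Rdel G b ≤ Rmin G b := by
  obtain ⟨N, hN⟩ := exists_nat_gt (max 1 (b * (2 * b + b * b) / δ))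
  have hN1 : (1 : ℝ) < N := (le_max_left _ _).trans_lt hN
  have hNδ : b * (2 * b + b * b) < N * δ :=
    (div_lt_iff₀ hδ).1 ((le_max_right _ _).trans_lt hN)
  have hpos := Rdel_procrastination_pos hb (N := N) (by exact_mod_cast zero_lt_one.trans hN1)
  refine ⟨_, procrastination N b hb, hpos, le_trans ?_ (le_Rmin_procrastination hb)⟩
  rcases le_or_gt b δ with hbδ | hbδ
  · exact (mul_nonpos_of_nonpos_of_nonneg (by linarith) hpos.le).trans (by positivity)
  · refine (mul_le_mul_of_nonneg_left (Rdel_procrastination_le hb) (by linarith)).trans ?_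
    have h1 : ((N : ℝ) + b - 1) * (N + b - 1) ≤ N * N + (2 * b + b * b) * N := by nlinarith
    have h2 : 0 ≤ (2 * b + b * b) * N := by positivity
    have h3 := mul_le_mul_of_nonneg_left h1 (by linarith : 0 ≤ b - δ)
    nlinarith

/-- The factor `b` between `R^min` and the deletion-optimal
reward `R_d` is tight: for every `b > 1` and `δ > 0` there is a planning
instance with `R^min(G) ≥ (b - δ) · R_d(G)`. -/
theorem rmin_vs_rdel_tight (b δ : ℝ) (hb : 1 < b) (hδ : 0 < δ) :
    ∃ (n : ℕ) (G : PlanningInstance n),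
      (b - δ) * Rdel G b ≤ Rmin G b := by
  obtain ⟨n, G, -, h⟩ := exists_planningInstance_Rdel_pos b δ hb hδ
  exact ⟨n, G, h⟩
end

section
/- Traversability is not monotone in the reward: there exists a planning instance G, a bias b > 1, and rewards R < R' such that G is traversable for reward R but not traversable for reward R'. Concretely, for b = 2, the instance with edges s→v of cost 3, v→w of cost 0, v→t of cost 3, and w→t of cost 5 is traversable for rewards 9 and 11 but not for reward 10. -/
theorem forall_fin_four {p : Fin 4 → Prop} : (∀ i, p i) ↔ p 0 ∧ p 1 ∧ p 2 ∧ p 3 := by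
  refine ⟨fun h => ⟨h 0, h 1, h 2, h 3⟩, fun ⟨h0, h1, h2, h3⟩ i => ?_⟩
  fin_cases i <;> assumption

theorem exists_fin_four {p : Fin 4 → Prop} : (∃ i, p i) ↔ p 0 ∨ p 1 ∨ p 2 ∨ p 3 := by
  simpa only [not_forall, not_not, not_and_or] using
    not_congr (forall_fin_four (p := fun i => ¬ p i))

/-- The edge relation `s → v → w → t`, `v → t` with `s, v, w, t = 0, 1, 2, 3`. -/
def IsShortcutEdge (p q : Fin 4) : Prop :=
  (p = 0 ∧ q = 1) ∨ (p = 1 ∧ q = 2) ∨ (p = 1 ∧ q = 3) ∨ (p = 2 ∧ q = 3)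

/-- The instance with edge relation `IsShortcutEdge` and costs `c(s,v) = 3`, `c(v,w) = 0`,
`c(v,t) = 3`, `c(w,t) = 5`. -/
def shortcutInstance : PlanningInstance 4 where
  E := IsShortcutEdge
  c := !![0, 3, 0, 0; 0, 0, 0, 3; 0, 0, 0, 5; 0, 0, 0, 0]
  s := 0
  t := 3
  edge_lt := by
    rintro u v (⟨rfl, rfl⟩ | ⟨rfl, rfl⟩ | ⟨rfl, rfl⟩ | ⟨rfl, rfl⟩) <;> decide
  c_nonneg := by
    rintro u v (⟨rfl, rfl⟩ | ⟨rfl, rfl⟩ | ⟨rfl, rfl⟩ | ⟨rfl, rfl⟩) <;> simp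
  reach := by
    rw [forall_fin_four]
    exact ⟨⟨[1, 3], by simp [IsPathTo, IsShortcutEdge]⟩, ⟨[3], by simp [IsPathTo, IsShortcutEdge]⟩,
      ⟨[3], by simp [IsPathTo, IsShortcutEdge]⟩, ⟨[], by simp [IsPathTo]⟩⟩

theorem traversableOn_shortcut (G : PlanningInstance 4) (hs : G.s = 0) (ht : G.t = 3)
    (hE : ∀ p q : Fin 4, G.E p q ↔ IsShortcutEdge p q)
    (h01 : G.c 0 1 = 3) (h12 : G.c 1 2 = 0) (h13 : G.c 1 3 = 3) (h23 : G.c 2 3 = 5) :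
    TraversableOn G G.E 2 9 ∧ ¬ TraversableOn G G.E 2 10 ∧ TraversableOn G G.E 2 11 := by
  refine ⟨⟨fun u => u ≠ 2, ![6, 3, 0, 0], ⟨?_, ?_, ?_, ?_⟩, ?_⟩, ?_,
    ⟨fun _ => True, ![8, 5, 5, 0], ⟨?_, ?_, ?_, ?_⟩, ?_⟩⟩
  case refine_6 =>
    rintro ⟨M, C, ⟨hMt, hCt, hM, hC⟩, hMs⟩
    rw [ht] at hMt hCt
    rw [hs] at hMs
    simp only [ht, hE, IsShortcutEdge, forall_fin_four, exists_fin_four] at hM hC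
    simp [h01, h12, h13, h23, hMt, hCt, hMs] at hM hC
    grind
  all_goals
    simp [hs, ht, hE, IsShortcutEdge, forall_fin_four, exists_fin_four, h01, h12, h13, h23] <;>
      norm_num

/-- Traversability is not monotone in the reward: there is
an instance, a bias `b > 1` and rewards `R < R'` with the graph traversable
for `R` but not for `R'`. Concretely, for `b = 2` the four-node instance with
`s = 0`, `v = 1`, `w = 2`, `t = 3` and costs `c(s,v) = 3`, `c(v,w) = 0`,
`c(v,t) = 3`, `c(w,t) = 5` is traversable for rewards `9` and `11` but not
for reward `10`. -/
theorem traversability_not_monotone :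
    (∃ (n : ℕ) (G : PlanningInstance n) (b R R' : ℝ),
      1 < b ∧ 0 ≤ R ∧ R < R' ∧
      TraversableOn G G.E b R ∧ ¬ TraversableOn G G.E b R') ∧
    (∀ G : PlanningInstance 4,
      G.s = 0 → G.t = 3 →
      (∀ p q : Fin 4, G.E p q ↔
        ((p = 0 ∧ q = 1) ∨ (p = 1 ∧ q = 2) ∨ (p = 1 ∧ q = 3) ∨
         (p = 2 ∧ q = 3))) →
      G.c 0 1 = 3 → G.c 1 2 = 0 → G.c 1 3 = 3 → G.c 2 3 = 5 →
      TraversableOn G G.E 2 9 ∧ ¬ TraversableOn G G.E 2 10 ∧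
        TraversableOn G G.E 2 11) := by
  refine ⟨⟨4, shortcutInstance, 2, 9, 10, by norm_num, by norm_num, by norm_num, ?_⟩,
    traversableOn_shortcut⟩
  have h := traversableOn_shortcut shortcutInstance rfl rfl (fun _ _ => Iff.rfl)
    (by simp [shortcutInstance]) (by simp [shortcutInstance]) (by simp [shortcutInstance])
    (by simp [shortcutInstance])
  exact ⟨h.1, h.2.1⟩
end

section
/- A sophisticated agent can traverse exponentially many distinct paths as the reward varies: for every integer n ≥ 1 and every pair b, c with 1 < c < b < 2 and 1 + c = b·c, there is a planning instance (the binary-counter graph) with 2n + 2 nodes — nodes s, v₀, …, v_{n−1}, w₀, …, w_{n−1}, t, edges s→v₀ of cost 0, vᵢ→v_{i+1} of cost 2ⁱ, vᵢ→wᵢ of cost 0, and wᵢ→v_{i+1} of cost c·2ⁱ (with vₙ identified with t) — such that for every integer 0 ≤ x ≤ 2ⁿ − 1, the graph is traversable for reward R_x = 2ⁿ + (bc − 2)·x, and the traversed path uses the bypass vᵢ→wᵢ→v_{i+1} exactly when the i-th bit of x equals 1. In particular, the 2ⁿ rewards R₀, …, R_{2ⁿ−1} induce 2ⁿ pairwise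 distinct traversed paths. -/
/-- The path traversed from a node in the presence of a reward `R` at `t`:
at each step the agent follows a motivated successor of minimal perceived
cost among feasible (motivated, affordable) edges. -/
inductive TraverseR {n : ℕ} (G : PlanningInstance n)
    (E' : Fin n → Fin n → Prop) (b R : ℝ)
    (M : Fin n → Prop) (C : Fin n → ℝ) : Fin n → List (Fin n) → Prop
  | nil : TraverseR G E' b R M C G.t []
  | cons {u v : Fin n} {l : List (Fin n)} (hne : u ≠ G.t) (hE : E' u v)
      (hM : M v) (hle : b * G.c u v + C v ≤ R)
      (hmin : ∀ w, E' u w → M w → b * G.c u w + C w ≤ R →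
        b * G.c u v + C v ≤ b * G.c u w + C w)
      (htail : TraverseR G E' b R M C v l) :
      TraverseR G E' b R M C u (v :: l)

/-- Total cost from `vᵢ` to `t = vₙ` of the path in the binary-counter graph that takes the
bypasses at the set bits of `x < 2ⁿ`, in closed form. -/
noncomputable def counterCost (n : ℕ) (c : ℝ) (x i : ℕ) : ℝ :=
  2 ^ n - 2 ^ i + (c - 1) * ((2 ^ i * (x / 2 ^ i) : ℕ) : ℝ)

theorem counterCost_self {n x : ℕ} (c : ℝ) (hx : x < 2 ^ n) : counterCost n c x n = 0 := by
  simp [counterCost, Nat.div_eq_of_lt hx]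

theorem two_pow_mul_div_two_pow (x i : ℕ) :
    2 ^ i * (x / 2 ^ i) =
      2 ^ (i + 1) * (x / 2 ^ (i + 1)) + if x.testBit i then 2 ^ i else 0 := by
  have hdiv : x / 2 ^ (i + 1) = x / 2 ^ i / 2 := by rw [pow_succ, Nat.div_div_eq_div_mul]
  have hbit : x.testBit i = decide (x / 2 ^ i % 2 = 1) := Nat.testBit_eq_decide_div_mod_eq
  rw [hdiv, hbit, pow_succ]
  have hmod := Nat.mod_add_div (x / 2 ^ i) 2
  rcases Nat.mod_two_eq_zero_or_one (x / 2 ^ i) with h | h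
  all_goals
    rw [h] at hmod
    simp only [h, decide_true, if_true, zero_ne_one, decide_false, Bool.false_eq_true, if_false]
    conv_lhs => rw [← hmod]
    ring

theorem counterCost_of_testBit {x i : ℕ} (n : ℕ) (c : ℝ) (h : x.testBit i = true) :
    counterCost n c x i = c * 2 ^ i + counterCost n c x (i + 1) := by
  unfold counterCost
  rw [two_pow_mul_div_two_pow x i, if_pos h]
  push_cast
  ring

theorem counterCost_of_not_testBit {x i : ℕ} (n : ℕ) (c : ℝ) (h : ¬ x.testBit i = true) :
    counterCost n c x i = 2 ^ i + counterCost n c x (i + 1) := by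
  unfold counterCost
  rw [two_pow_mul_div_two_pow x i, if_neg h]
  push_cast
  ring

theorem counterCost_le {c : ℝ} (hc : 1 < c) (n x i : ℕ) :
    2 ^ i + counterCost n c x i ≤ 2 ^ n + (c - 1) * x := by
  have h : ((2 ^ i * (x / 2 ^ i) : ℕ) : ℝ) ≤ x := by exact_mod_cast Nat.mul_div_le x (2 ^ i)
  unfold counterCost
  nlinarith

/-- The bypass at bit `i` is affordable exactly when that bit of `x` is set. -/
theorem bypass_le_iff_testBit {c : ℝ} (hc : 1 < c) (n x i : ℕ) :
    (1 + c) * 2 ^ i + counterCost n c x (i + 1) ≤ 2 ^ n + (c - 1) * x ↔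
      x.testBit i = true := by
  constructor
  · intro hle
    by_contra h
    have hlt : x < 2 ^ i * (x / 2 ^ i) + 2 ^ i := by
      have := Nat.lt_mul_div_succ x (Nat.two_pow_pos i)
      rwa [mul_add, mul_one] at this
    have hlt' : (x : ℝ) < ((2 ^ i * (x / 2 ^ i) : ℕ) : ℝ) + 2 ^ i := by exact_mod_cast hlt
    have hcost := counterCost_of_not_testBit n c h
    unfold counterCost at hcost hle
    nlinarith
  · intro h
    have := counterCost_le hc n x i
    rw [counterCost_of_testBit n c h] at this
    linarith

/-- The edge `u → v` is feasible and has minimal perceived cost among the feasible edges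
leaving `u`. -/
def IsBestEdge {n : ℕ} (G : PlanningInstance n) (b R : ℝ)
    (M : Fin n → Prop) (C : Fin n → ℝ) (u v : Fin n) : Prop :=
  G.E u v ∧ M v ∧ b * G.c u v + C v ≤ R ∧
    ∀ w, G.E u w → M w → b * G.c u w + C w ≤ R → b * G.c u v + C v ≤ b * G.c u w + C w

theorem IsBestEdge.traverseR {n : ℕ} {G : PlanningInstance n} {b R : ℝ}
    {M : Fin n → Prop} {C : Fin n → ℝ} {u v : Fin n} {l : List (Fin n)}
    (h : IsBestEdge G b R M C u v) (hne : u ≠ G.t) (hl : TraverseR G G.E b R M C v l) :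
    TraverseR G G.E b R M C u (v :: l) :=
  .cons hne h.1 h.2.1 h.2.2.1 h.2.2.2 hl

/-- The motivated nodes of the binary-counter graph: every node except the `wᵢ` at unset bits. -/
def counterMotivated (n x : ℕ) (u : Fin (2 * n + 2)) : Prop :=
  (u : ℕ) = 0 ∨ (u : ℕ) % 2 = 1 ∨ x.testBit ((u : ℕ) / 2 - 1) = true

/-- The pruned sophisticated cost of the nodes of the binary-counter graph. -/
noncomputable def counterNodeCost (n : ℕ) (c : ℝ) (x : ℕ) (u : Fin (2 * n + 2)) : ℝ :=
  if (u : ℕ) = 0 then counterCost n c x 0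
  else if (u : ℕ) % 2 = 1 then counterCost n c x ((u : ℕ) / 2)
  else c * 2 ^ ((u : ℕ) / 2 - 1) + counterCost n c x ((u : ℕ) / 2)


/-- The binary-counter graph: for `1 < c < b < 2` with
`1 + c = b·c`, the instance on `2n + 2` nodes with `s`, `v₀, …, vₙ = t`,
`w₀, …, w_{n-1}`, edges `s → v₀` of cost `0`, `vᵢ → v_{i+1}` of cost `2ⁱ`,
`vᵢ → wᵢ` of cost `0` and `wᵢ → v_{i+1}` of cost `c·2ⁱ`, is traversable for
the reward `R_x = 2ⁿ + (bc − 2)·x` for every integer `0 ≤ x ≤ 2ⁿ − 1`, and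
the traversed path uses the bypass `vᵢ → wᵢ → v_{i+1}` exactly when the
`i`-th bit of `x` is `1`; hence the `2ⁿ` rewards induce `2ⁿ` distinct paths. -/
theorem binary_counter_exponentially_many_paths (n : ℕ) (hn : 1 ≤ n)
    (b c : ℝ) (hc1 : 1 < c) (hcb : c < b) (hb2 : b < 2)
    (hbc : 1 + c = b * c)
    (G : PlanningInstance (2 * n + 2))
    (vnode wnode : ℕ → Fin (2 * n + 2))
    (hv : ∀ i, i ≤ n → (vnode i : ℕ) = 2 * i + 1)
    (hw : ∀ i, i < n → (wnode i : ℕ) = 2 * i + 2)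
    (hs : (G.s : ℕ) = 0) (ht : G.t = vnode n)
    (hE : ∀ u v : Fin (2 * n + 2), G.E u v ↔
      ((u = G.s ∧ v = vnode 0) ∨
       (∃ i, i < n ∧ u = vnode i ∧ v = vnode (i + 1)) ∨
       (∃ i, i < n ∧ u = vnode i ∧ v = wnode i) ∨
       (∃ i, i < n ∧ u = wnode i ∧ v = vnode (i + 1))))
    (hc0 : G.c G.s (vnode 0) = 0)
    (hcv : ∀ i, i < n → G.c (vnode i) (vnode (i + 1)) = 2 ^ i)
    (hcw : ∀ i, i < n → G.c (vnode i) (wnode i) = 0)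
    (hcwv : ∀ i, i < n → G.c (wnode i) (vnode (i + 1)) = c * 2 ^ i) :
    ∀ x : ℕ, x ≤ 2 ^ n - 1 →
      ∃ (M : Fin (2 * n + 2) → Prop) (C : Fin (2 * n + 2) → ℝ),
        RewardSpecOn G G.E b ((2 : ℝ) ^ n + (b * c - 2) * (x : ℝ)) M C ∧
        M G.s ∧
        ∃ l, TraverseR G G.E b ((2 : ℝ) ^ n + (b * c - 2) * (x : ℝ)) M C G.s l ∧
          ∀ i, i < n → (wnode i ∈ l ↔ x.testBit i) := by
  intro x hx
  have hx' : x < 2 ^ n := by have := Nat.two_pow_pos n; omega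
  have hR : b * c - 2 = c - 1 := by linarith
  rw [hR]
  set R : ℝ := 2 ^ n + (c - 1) * x
  set M := counterMotivated n x with hM
  set C := counterNodeCost n c x with hC
  have cases_node : ∀ u : Fin (2 * n + 2),
      u = G.s ∨ (∃ i, i ≤ n ∧ u = vnode i) ∨ ∃ i, i < n ∧ u = wnode i := by
    intro u
    have hu := u.isLt
    rcases Nat.eq_zero_or_pos (u : ℕ) with h0 | h0
    · exact .inl (Fin.ext (by omega))
    rcases Nat.mod_two_eq_zero_or_one (u : ℕ) with h | h
    · refine .inr (.inr ⟨(u : ℕ) / 2 - 1, by omega, Fin.ext ?_⟩)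
      rw [hw _ (by omega)]; omega
    · refine .inr (.inl ⟨(u : ℕ) / 2, by omega, Fin.ext ?_⟩)
      rw [hv _ (by omega)]; omega
  have v_inj : ∀ i j, i ≤ n → j ≤ n → vnode i = vnode j → i = j := by
    intro i j hi hj h
    have := congrArg Fin.val h
    rw [hv i hi, hv j hj] at this; omega
  have w_inj : ∀ i j, i < n → j < n → wnode i = wnode j → i = j := by
    intro i j hi hj h
    have := congrArg Fin.val h
    rw [hw i hi, hw j hj] at this; omega
  have v_ne_w : ∀ i j, i ≤ n → j < n → vnode i ≠ wnode j := by
    intro i j hi hj h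
    have := congrArg Fin.val h
    rw [hv i hi, hw j hj] at this; omega
  have s_ne_v : ∀ i, i ≤ n → G.s ≠ vnode i := by
    intro i hi h
    have := congrArg Fin.val h
    rw [hs, hv i hi] at this; omega
  have s_ne_w : ∀ i, i < n → G.s ≠ wnode i := by
    intro i hi h
    have := congrArg Fin.val h
    rw [hs, hw i hi] at this; omega
  have edge_s : ∀ w, G.E G.s w → w = vnode 0 := by
    intro w h
    rcases (hE _ _).1 h with h | ⟨i, hi, h, -⟩ | ⟨i, hi, h, -⟩ | ⟨i, hi, h, -⟩
    · exact h.2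
    · exact absurd h (s_ne_v i hi.le)
    · exact absurd h (s_ne_v i hi.le)
    · exact absurd h (s_ne_w i hi)
  have edge_v : ∀ i, i < n → ∀ w, G.E (vnode i) w → w = vnode (i + 1) ∨ w = wnode i := by
    intro i hi w h
    rcases (hE _ _).1 h with ⟨h, -⟩ | ⟨j, hj, h, hw'⟩ | ⟨j, hj, h, hw'⟩ | ⟨j, hj, h, -⟩
    · exact absurd h.symm (s_ne_v i hi.le)
    · obtain rfl := v_inj i j hi.le hj.le h
      exact .inl hw'
    · obtain rfl := v_inj i j hi.le hj.le h
      exact .inr hw'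
    · exact absurd h (v_ne_w i j hi.le hj)
  have edge_w : ∀ i, i < n → ∀ w, G.E (wnode i) w → w = vnode (i + 1) := by
    intro i hi w h
    rcases (hE _ _).1 h with ⟨h, -⟩ | ⟨j, hj, h, -⟩ | ⟨j, hj, h, -⟩ | ⟨j, hj, h, hw'⟩
    · exact absurd h.symm (s_ne_w i hi)
    · exact absurd h.symm (v_ne_w j i hj.le hi)
    · exact absurd h.symm (v_ne_w j i hj.le hi)
    · obtain rfl := w_inj i j hi hj h
      exact hw'
  have M_s : M G.s := .inl hs
  have M_v : ∀ i, i ≤ n → M (vnode i) := fun i hi ↦ .inr (.inl (by rw [hv i hi]; omega))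
  have M_w : ∀ i, i < n → (M (wnode i) ↔ x.testBit i = true) := by
    intro i hi
    have h1 : (2 * i + 2) / 2 - 1 = i := by omega
    have h2 : (2 * i + 2) % 2 ≠ 1 := by omega
    simp only [hM, counterMotivated, hw i hi, h1, h2, false_or]
    simp
  have C_s : C G.s = counterCost n c x 0 := by simp [hC, counterNodeCost, hs]
  have C_v : ∀ i, i ≤ n → C (vnode i) = counterCost n c x i := by
    intro i hi
    have h1 : (2 * i + 1) / 2 = i := by omega
    have h2 : (2 * i + 1) % 2 = 1 := by omega
    simp [hC, counterNodeCost, hv i hi, h1, h2]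
  have C_w : ∀ i, i < n → C (wnode i) = c * 2 ^ i + counterCost n c x (i + 1) := by
    intro i hi
    have h1 : (2 * i + 2) / 2 = i + 1 := by omega
    simp [hC, counterNodeCost, hw i hi, h1]
  have best_s : IsBestEdge G b R M C G.s (vnode 0) := by
    refine ⟨(hE _ _).2 (.inl ⟨rfl, rfl⟩), M_v 0 (Nat.zero_le n), ?_, ?_⟩
    · rw [hc0, C_v 0 (Nat.zero_le n)]
      linarith [counterCost_le hc1 n x 0, pow_pos (two_pos : (0 : ℝ) < 2) 0]
    · intro w hw' _ _
      rw [edge_s w hw']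
  have best_w : ∀ i, i < n → x.testBit i = true →
      IsBestEdge G b R M C (wnode i) (vnode (i + 1)) := by
    intro i hi hbit
    refine ⟨(hE _ _).2 (.inr (.inr (.inr ⟨i, hi, rfl, rfl⟩))), M_v _ hi, ?_, ?_⟩
    · rw [hcwv i hi, C_v _ hi, ← mul_assoc, ← hbc]
      exact (bypass_le_iff_testBit hc1 n x i).2 hbit
    · intro w hw' _ _
      rw [edge_w i hi w hw']
  have best_v_bypass : ∀ i, i < n → x.testBit i = true →
      IsBestEdge G b R M C (vnode i) (wnode i) := by
    intro i hi hbit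
    have hpow : (0 : ℝ) < 2 ^ i := by positivity
    refine ⟨(hE _ _).2 (.inr (.inr (.inl ⟨i, hi, rfl, rfl⟩))), (M_w i hi).2 hbit, ?_, ?_⟩
    · rw [hcw i hi, C_w i hi]
      linarith [(bypass_le_iff_testBit hc1 n x i).2 hbit]
    · intro w hw' _ _
      rcases edge_v i hi w hw' with rfl | rfl
      · rw [hcw i hi, C_w i hi, hcv i hi, C_v _ hi]
        nlinarith
      · exact le_rfl
  have best_v_direct : ∀ i, i < n → ¬ x.testBit i = true →
      IsBestEdge G b R M C (vnode i) (vnode (i + 1)) := by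
    intro i hi hbit
    have hpow : (0 : ℝ) < 2 ^ i := by positivity
    refine ⟨(hE _ _).2 (.inr (.inl ⟨i, hi, rfl, rfl⟩)), M_v _ hi, ?_, ?_⟩
    · rw [hcv i hi, C_v _ hi]
      have := counterCost_le hc1 n x (i + 1)
      rw [pow_succ] at this
      nlinarith
    · rintro w hw' hMw -
      rcases edge_v i hi w hw' with rfl | rfl
      · exact le_rfl
      · exact absurd ((M_w i hi).1 hMw) hbit
  have best : ∀ u, u ≠ G.t → M u →
      ∃ v, IsBestEdge G b R M C u v ∧ C u = G.c u v + C v := by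
    intro u hu hMu
    rcases cases_node u with rfl | ⟨i, hi, rfl⟩ | ⟨i, hi, rfl⟩
    · exact ⟨_, best_s, by rw [hc0, C_s, C_v 0 (Nat.zero_le n), zero_add]⟩
    · have hi' : i < n := lt_of_le_of_ne hi (by rintro rfl; exact hu ht.symm)
      by_cases hbit : x.testBit i = true
      · refine ⟨_, best_v_bypass i hi' hbit, ?_⟩
        rw [hcw i hi', C_v i hi, C_w i hi', zero_add, counterCost_of_testBit n c hbit]
      · refine ⟨_, best_v_direct i hi' hbit, ?_⟩
        rw [hcv i hi', C_v i hi, C_v _ hi', counterCost_of_not_testBit n c hbit]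
    · exact ⟨_, best_w i hi ((M_w i hi).1 hMu), by rw [hcwv i hi, C_w i hi, C_v _ hi]⟩
  have path_v : ∀ i, i ≤ n → ∃ l, TraverseR G G.E b R M C (vnode i) l ∧
      ∀ j, j < n → (wnode j ∈ l ↔ i ≤ j ∧ x.testBit j = true) := by
    intro i hi
    induction hi using Nat.decreasingInduction with
    | self => exact ⟨[], ht ▸ .nil, fun j hj ↦ by simp; omega⟩
    | of_succ i hi ih =>
      obtain ⟨l, hl, hmem⟩ := ih
      have v_ne_t : vnode i ≠ G.t := by
        rw [ht]
        exact fun h ↦ hi.ne (v_inj i n hi.le le_rfl h)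
      have w_ne_t : wnode i ≠ G.t := by
        rw [ht]
        exact (v_ne_w n i le_rfl hi).symm
      by_cases hbit : x.testBit i = true
      · refine ⟨_, (best_v_bypass i hi hbit).traverseR v_ne_t
          ((best_w i hi hbit).traverseR w_ne_t hl), fun j hj ↦ ?_⟩
        have hne := (v_ne_w (i + 1) j hi hj).symm
        have hw_eq : wnode j = wnode i ↔ j = i := ⟨w_inj j i hj hi, congrArg wnode⟩
        rw [List.mem_cons, List.mem_cons, hmem j hj, hw_eq]
        rcases eq_or_ne j i with rfl | hji
        · simp [hbit]
        · have : i + 1 ≤ j ↔ i ≤ j := by omega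
          simp [hne, hji, this]
      · refine ⟨_, (best_v_direct i hi hbit).traverseR v_ne_t hl, fun j hj ↦ ?_⟩
        have hne := (v_ne_w (i + 1) j hi hj).symm
        rw [List.mem_cons, hmem j hj]
        rcases eq_or_ne j i with rfl | hji
        · simp [hbit, hne]
        · have : i + 1 ≤ j ↔ i ≤ j := by omega
          simp [hne, this]
  refine ⟨M, C, ⟨?_, ?_, ?_, ?_⟩, M_s, ?_⟩
  · rw [ht]
    exact M_v n le_rfl
  · rw [ht, C_v n le_rfl, counterCost_self c hx']
  · refine fun u hu ↦ ⟨fun hMu ↦ ?_, ?_⟩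
    · obtain ⟨v, ⟨hEv, hMv, hle, -⟩, -⟩ := best u hu hMu
      exact ⟨v, hEv, hMv, hle⟩
    · rintro ⟨v, hEv, -, hle⟩
      rcases cases_node u with rfl | ⟨i, hi, rfl⟩ | ⟨i, hi, rfl⟩
      · exact M_s
      · exact M_v i hi
      · rw [edge_w i hi v hEv, hcwv i hi, C_v _ hi, ← mul_assoc, ← hbc] at hle
        exact (M_w i hi).2 ((bypass_le_iff_testBit hc1 n x i).1 hle)
  · intro u hu hMu
    obtain ⟨v, ⟨hEv, hMv, hle, hmin⟩, hCu⟩ := best u hu hMu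
    exact ⟨v, hEv, hMv, hle, hCu, hmin⟩
  · obtain ⟨l, hl, hmem⟩ := path_v 0 (Nat.zero_le n)
    refine ⟨_, best_s.traverseR (ht ▸ s_ne_v n le_rfl) hl, fun i hi ↦ ?_⟩
    rw [List.mem_cons, hmem i hi]
    simp [(v_ne_w 0 i (Nat.zero_le n) hi).symm]
end

section
/- Internal rewards are no more powerful than edge deletion: for every planning instance G with bias b > 1, the minimum total internal reward R_i(G) needed to motivate the agent to reach t is at least the minimum reward R_d(G) needed when edges may be deleted, i.e., R_d(G) ≤ R_i(G). -/
/-- Motivated set and pruned cost for an internal reward assignment `r` on the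
edges (rewards are collected after traversing an edge, so they are not
weighted by `b`). -/
structure InternalRewardSpec {n : ℕ} (G : PlanningInstance n) (b : ℝ)
    (r : Fin n → Fin n → ℝ) (M : Fin n → Prop) (C : Fin n → ℝ) : Prop where
  m_t : M G.t
  c_t : C G.t = 0
  m_iff : ∀ u, u ≠ G.t →
    (M u ↔ ∃ v, G.E u v ∧ M v ∧ b * G.c u v - r u v + C v ≤ 0)
  c_min : ∀ u, u ≠ G.t → M u →
    ∃ v, G.E u v ∧ M v ∧ b * G.c u v - r u v + C v ≤ 0 ∧
      C u = G.c u v - r u v + C v ∧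
      (∀ w, G.E u w → M w → b * G.c u w - r u w + C w ≤ 0 →
        b * G.c u v - r u v + C v ≤ b * G.c u w - r u w + C w)

/-- `R_i(G)`: the minimum total internal reward (distributed on the edges)
that motivates the agent to reach `t`. -/
noncomputable def Rint {n : ℕ} (G : PlanningInstance n) (b : ℝ) : ℝ :=
  sInf {B : ℝ | ∃ r : Fin n → Fin n → ℝ,
    (∀ u v, 0 ≤ r u v) ∧ (∀ u v, ¬ G.E u v → r u v = 0) ∧
    (∑ u, ∑ v, r u v) = B ∧
    ∃ M C, InternalRewardSpec G b r M C ∧ M G.s}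

theorem IsPathTo.le_target {n : ℕ} (G : PlanningInstance n) :
    ∀ (l : List (Fin n)) (u : Fin n), IsPathTo G.E G.t u l → u ≤ G.t
  | [], _, h => le_of_eq h
  | v :: l, u, h => (G.edge_lt u v h.1).le.trans (le_target G l v h.2)

theorem PlanningInstance.le_target {n : ℕ} (G : PlanningInstance n) (u : Fin n) :
    u ≤ G.t :=
  let ⟨l, hl⟩ := G.reach u
  IsPathTo.le_target G l u hl

theorem PlanningInstance.exists_edge {n : ℕ} (G : PlanningInstance n) {u : Fin n}
    (hu : u ≠ G.t) : ∃ v, G.E u v := by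
  obtain ⟨l, hl⟩ := G.reach u
  cases l with
  | nil => exact absurd hl hu
  | cons v l => exact ⟨v, hl.1⟩

theorem PlanningInstance.not_edge_target {n : ℕ} (G : PlanningInstance n) (v : Fin n) :
    ¬ G.E G.t v := fun h => (G.le_target v).not_gt (G.edge_lt _ _ h)

/-- Total cost of following the successor function `f` until it stops increasing. -/
noncomputable def followCost {n : ℕ} (c : Fin n → Fin n → ℝ) (f : Fin n → Fin n)
    (u : Fin n) : ℝ :=
  if u < f u then c u (f u) + followCost c f (f u) else 0
termination_by n - u.val
decreasing_by omega

/-- A potential on a planning instance that follows, at every node other than the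
target, an edge to an out-neighbour of least potential. -/
theorem PlanningInstance.exists_greedy_potential {n : ℕ} (G : PlanningInstance n)
    (d : Fin n → Fin n → ℝ) :
    ∃ C : Fin n → ℝ, C G.t = 0 ∧ ∀ u, u ≠ G.t →
      ∃ v, G.E u v ∧ C u = d u v + C v ∧ ∀ w, G.E u w → C v ≤ C w := by
  classical
  let F : (u : Fin n) → ((v : Fin n) → v > u → ℝ) → ℝ := fun u rec =>
    if h : ∃ v, ∃ e : G.E u v, ∀ w (e' : G.E u w),
        rec v (G.edge_lt u v e) ≤ rec w (G.edge_lt u w e') then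
      d u h.choose + rec h.choose (G.edge_lt u _ h.choose_spec.choose)
    else 0
  let hwf : WellFounded (fun a b : Fin n => a > b) := wellFounded_gt
  have hC : ∀ u, hwf.fix F u = F u fun v _ => hwf.fix F v := fun u => hwf.fix_eq F u
  refine ⟨hwf.fix F, ?_, fun u hu => ?_⟩
  · rw [hC]
    exact dif_neg fun ⟨v, e, _⟩ => G.not_edge_target v e
  · obtain ⟨v, hv, hmin⟩ := Set.exists_min_image {v | G.E u v} (hwf.fix F)
      (Set.toFinite _) (G.exists_edge hu)
    have h : ∃ v, ∃ _ : G.E u v, ∀ w (_ : G.E u w), hwf.fix F v ≤ hwf.fix F w :=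
      ⟨v, hv, hmin⟩
    refine ⟨h.choose, h.choose_spec.choose, ?_, h.choose_spec.choose_spec⟩
    rw [hC]
    exact dif_pos h

/-- Paying `b·c(u,v)` on every edge motivates the agent at every node. -/
theorem PlanningInstance.exists_internalRewardSpec {n : ℕ} (G : PlanningInstance n) {b : ℝ}
    (hb : 1 ≤ b) : ∃ r : Fin n → Fin n → ℝ,
      (∀ u v, 0 ≤ r u v) ∧ (∀ u v, ¬ G.E u v → r u v = 0) ∧
      ∃ C, InternalRewardSpec G b r (fun _ => True) C := by
  classical
  obtain ⟨C, hCt, hC⟩ := G.exists_greedy_potential fun u v => (1 - b) * G.c u v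
  have hneg : ∀ u, C u ≤ 0 := by
    intro u
    induction u using WellFoundedGT.induction with
    | _ u ih =>
      by_cases hu : u = G.t
      · rw [hu, hCt]
      · obtain ⟨v, e, h, -⟩ := hC u hu
        have := ih v (G.edge_lt u v e)
        nlinarith [G.c_nonneg u v e]
  refine ⟨fun u v => if G.E u v then b * G.c u v else 0, fun u v => ?_,
    fun u v h => if_neg h, C, trivial, hCt, fun u hu => ?_, fun u hu _ => ?_⟩
  · dsimp only
    split_ifs with h
    · exact mul_nonneg (by linarith) (G.c_nonneg u v h)
    · exact le_rfl
  · obtain ⟨v, e⟩ := G.exists_edge hu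
    exact iff_of_true trivial ⟨v, e, trivial, by simpa [e] using hneg v⟩
  · obtain ⟨v, e, h, hmin⟩ := hC u hu
    refine ⟨v, e, trivial, by simpa [e] using hneg v, ?_, fun w e' _ _ => ?_⟩
    · simp only [e, if_true, h]
      ring
    · simpa [e, e'] using hmin w e'

/-- Keeping only the edges chosen by an agent motivated by internal rewards `r`, the
total of `r` placed at the target motivates the agent at the same nodes. -/
theorem InternalRewardSpec.exists_rewardSpecOn {n : ℕ} {G : PlanningInstance n} {b : ℝ}
    {r : Fin n → Fin n → ℝ} {M : Fin n → Prop} {C : Fin n → ℝ}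
    (h : InternalRewardSpec G b r M C) (hr : ∀ u v, 0 ≤ r u v) :
    ∃ E' : Fin n → Fin n → Prop, (∀ u v, E' u v → G.E u v) ∧
      ∃ C', RewardSpecOn G E' b (∑ u, ∑ v, r u v) M C' := by
  have hex : ∀ u, ∃ v, (u ≠ G.t → M u → G.E u v ∧ M v ∧
      b * G.c u v - r u v + C v ≤ 0 ∧ C u = G.c u v - r u v + C v) := by
    intro u
    by_cases hu : u ≠ G.t ∧ M u
    · obtain ⟨v, h1, h2, h3, h4, -⟩ := h.c_min u hu.1 hu.2
      exact ⟨v, fun _ _ => ⟨h1, h2, h3, h4⟩⟩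
    · exact ⟨u, fun h1 h2 => absurd ⟨h1, h2⟩ hu⟩
  choose f hf using hex
  have hct : followCost G.c f G.t = 0 := by
    rw [followCost, if_neg (G.le_target _).not_gt]
  have hcu : ∀ u, u ≠ G.t → M u →
      followCost G.c f u = G.c u (f u) + followCost G.c f (f u) := by
    intro u hu hM
    rw [followCost, if_pos (G.edge_lt _ _ (hf u hu hM).1)]
  have hrow : ∀ u, 0 ≤ ∑ v, r u v := fun u => Finset.sum_nonneg fun v _ => hr u v
  have hpaid : ∀ u, M u → followCost G.c f u - C u ≤ ∑ w ∈ Finset.Ici u, ∑ v, r w v := by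
    intro u
    induction u using WellFoundedGT.induction with
    | _ u ih =>
      intro hM
      by_cases hu : u = G.t
      · rw [hu, hct, h.c_t, sub_zero]
        exact Finset.sum_nonneg fun w _ => hrow w
      · obtain ⟨e, hM', -, hCu⟩ := hf u hu hM
        have hlt := G.edge_lt _ _ e
        have h1 := ih (f u) hlt hM'
        have h2 : r u (f u) ≤ ∑ v, r u v :=
          Finset.single_le_sum (fun v _ => hr u v) (Finset.mem_univ (f u))
        have h3 : ∑ w ∈ Finset.Ici (f u), ∑ v, r w v ≤ ∑ w ∈ Finset.Ioi u, ∑ v, r w v :=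
          Finset.sum_le_sum_of_subset_of_nonneg
            (fun w hw => Finset.mem_Ioi.2 (hlt.trans_le (Finset.mem_Ici.1 hw)))
            fun w _ _ => hrow w
        have h4 : ∑ w ∈ Finset.Ici u, ∑ v, r w v =
            ∑ v, r u v + ∑ w ∈ Finset.Ioi u, ∑ v, r w v := by
          rw [← Finset.Ioi_insert, Finset.sum_insert (by simp)]
        have h5 := hcu u hu hM
        linarith
  have hmot : ∀ u, u ≠ G.t → M u →
      b * G.c u (f u) + followCost G.c f (f u) ≤ ∑ u, ∑ v, r u v := by
    intro u hu hM
    obtain ⟨-, -, hle, hCu⟩ := hf u hu hM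
    have h1 := hpaid u hM
    have h2 : ∑ w ∈ Finset.Ici u, ∑ v, r w v ≤ ∑ w, ∑ v, r w v :=
      Finset.sum_le_sum_of_subset_of_nonneg (Finset.subset_univ _) fun w _ _ => hrow w
    have h3 := hcu u hu hM
    linarith
  refine ⟨fun u v => u ≠ G.t ∧ M u ∧ v = f u, ?_, followCost G.c f, h.m_t, hct, ?_, ?_⟩
  · rintro u v ⟨hu, hM, rfl⟩
    exact (hf u hu hM).1
  · exact fun u hu => ⟨fun hM => ⟨f u, ⟨hu, hM, rfl⟩, (hf u hu hM).2.1, hmot u hu hM⟩,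
      fun ⟨_, h', _⟩ => h'.2.1⟩
  · intro u hu hM
    refine ⟨f u, ⟨hu, hM, rfl⟩, (hf u hu hM).2.1, hmot u hu hM, hcu u hu hM, ?_⟩
    rintro w ⟨-, -, rfl⟩ - -
    exact le_rfl

/-- Internal rewards are no more powerful than edge
deletion: `R_d(G) ≤ R_i(G)` for every planning instance with bias `b > 1`. -/
theorem deletion_at_most_internal {n : ℕ} (G : PlanningInstance n) (b : ℝ)
    (hb : 1 < b) : Rdel G b ≤ Rint G b := by
  apply le_csInf
  · obtain ⟨r, h0, hE, C, hC⟩ := G.exists_internalRewardSpec hb.le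
    exact ⟨_, r, h0, hE, rfl, _, C, hC, trivial⟩
  · rintro B ⟨r, h0, -, rfl, M, C, hC, hs⟩
    obtain ⟨E', hE', C', hC'⟩ := hC.exists_rewardSpecOn h0
    exact csInf_le ⟨0, fun R hR => hR.1⟩
      ⟨Finset.sum_nonneg fun u _ => Finset.sum_nonneg fun v _ => h0 u v,
        E', hE', M, C', hC', hs⟩
end

section
/- Edge deletion can be strictly more powerful than internal rewards by a factor approaching 2: for every ε > 0 there exists a planning instance G with bias b > 1 in which R_i(G) ≥ (2 − ε) · R_d(G). -/
/-- Edge relation on `0, …, N + 1`: line edges `u → u + 1`, together with jumps of length `m`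
landing at a node at most `N`. -/
def JumpEdge (m N u v : ℕ) : Prop :=
  (v = u + 1 ∧ u ≤ N) ∨ (v = u + m ∧ v ≤ N)

/-- Line edges before `N` cost `1 / (K * m)`; jumps and the last line edge cost `1 / m`. -/
noncomputable def jumpCost (K m N u v : ℕ) : ℝ :=
  if v = u + 1 ∧ u < N then 1 / (K * m) else 1 / m

lemma jumpCost_line {K m N u : ℕ} (hu : u < N) : jumpCost K m N u (u + 1) = 1 / (K * m) := by
  simp [jumpCost, hu]

lemma jumpCost_last {K m N : ℕ} : jumpCost K m N N (N + 1) = 1 / m := by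
  simp [jumpCost]

lemma jumpCost_jump {K m N u : ℕ} (hm : 2 ≤ m) : jumpCost K m N u (u + m) = 1 / m := by
  have : m ≠ 1 := by omega
  simp [jumpCost, this]

lemma jumpCost_nonneg (K m N u v : ℕ) : 0 ≤ jumpCost K m N u v := by
  unfold jumpCost
  split_ifs <;> positivity

/-- Every jump lands at most at `N`, so no walk can bypass the node `N`. -/
lemma of_forall_exists_jumpEdge {m N : ℕ} (hm : 2 ≤ m) {M : ℕ → Prop}
    (h : ∀ u ≤ N, M u → ∃ v, JumpEdge m N u v ∧ M v) {u : ℕ} (hu : u ≤ N) (hMu : M u) : M N := by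
  induction hd : N - u using Nat.strong_induction_on generalizing u with
  | _ d ih =>
    obtain rfl | hlt := hu.eq_or_lt
    · exact hMu
    obtain ⟨v, hE, hMv⟩ := h u hu hMu
    have hv : u < v ∧ v ≤ N := by
      rcases hE with hE | hE <;> omega
    exact ih (N - v) (by omega) hv.2 hMv rfl

/-- The line with jumps, from source `0` to target `N + 1`. -/
noncomputable def jumpInstance (K m N : ℕ) (hm : 2 ≤ m) : PlanningInstance (N + 2) where
  E u v := JumpEdge m N u v
  c u v := jumpCost K m N u v
  s := 0
  t := Fin.last (N + 1)
  edge_lt u v h := by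
    rw [Fin.lt_def]
    rcases h with h | h <;> omega
  c_nonneg u v _ := jumpCost_nonneg K m N u v
  reach u := by
    induction u using Fin.reverseInduction with
    | last => exact ⟨[], rfl⟩
    | cast i ih =>
      obtain ⟨l, hl⟩ := ih
      exact ⟨i.succ :: l, Or.inl ⟨by simp, by simpa using Nat.lt_succ_iff.mp i.isLt⟩, hl⟩

/-- In the line with jumps, every internal reward assignment motivating the source has
total at least `2 - 2 / K`. -/
lemma two_sub_le_sum_reward {K m N : ℕ} (hK : 1 ≤ K) (hm : 2 ≤ m) (hN : N = 2 * K * m)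
    {r : ℕ → ℕ → ℝ} {M : ℕ → Prop} {C : ℕ → ℝ} (hr : ∀ u v, 0 ≤ r u v)
    (hCt : C (N + 1) = 0)
    (hiff : ∀ u ≤ N, M u ↔
      ∃ v, JumpEdge m N u v ∧ M v ∧ m * jumpCost K m N u v - r u v + C v ≤ 0)
    (hmin : ∀ u ≤ N, M u → ∃ v, JumpEdge m N u v ∧ M v ∧
      m * jumpCost K m N u v - r u v + C v ≤ 0 ∧ C u = jumpCost K m N u v - r u v + C v ∧
      (∀ w, JumpEdge m N u w → M w → m * jumpCost K m N u w - r u w + C w ≤ 0 →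
        m * jumpCost K m N u v - r u v + C v ≤ m * jumpCost K m N u w - r u w + C w))
    (hMs : M 0) :
    2 - 2 / (K : ℝ) ≤ ∑ u ∈ Finset.range (N + 2), ∑ v ∈ Finset.range (N + 2), r u v := by
  have hK0 : (0 : ℝ) < K := by exact_mod_cast hK
  have hm0 : (0 : ℝ) < m := by exact_mod_cast (by omega : 0 < m)
  by_contra! hP
  set P := ∑ u ∈ Finset.range (N + 2), ∑ v ∈ Finset.range (N + 2), r u v with hPdef
  set a : ℝ := 1 / (K * m) with ha
  have ha0 : 0 < a := by positivity
  have hma : m * a = 1 / K := by rw [ha]; field_simp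
  have hmm : (m : ℝ) * (1 / m) = 1 := by field_simp
  have hK2 : 2 / (K : ℝ) = 1 / K + 1 / K := by ring
  have hMN : M N := of_forall_exists_jumpEdge hm (fun u hu h ↦ by
    obtain ⟨v, h1, h2, -⟩ := (hiff u hu).1 h
    exact ⟨v, h1, h2⟩) (Nat.zero_le N) hMs
  have hlast : 1 ≤ r N (N + 1) := by
    obtain ⟨v, hE, -, hle⟩ := (hiff N le_rfl).1 hMN
    obtain rfl : v = N + 1 := by rcases hE with hE | hE <;> omega
    rw [jumpCost_last, hCt, hmm] at hle
    linarith
  have hrow : ∀ u, ∀ v < N + 2, r u v ≤ ∑ v ∈ Finset.range (N + 2), r u v := fun u v hv ↦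
    Finset.single_le_sum (f := r u) (fun w _ ↦ hr u w) (Finset.mem_range.2 hv)
  have hjump : ∀ j, j + m ≤ N → r j (j + m) < 1 - 2 / K := by
    intro j hj
    have h1 : ∑ u ∈ {j, N}, ∑ v ∈ Finset.range (N + 2), r u v ≤ P := by
      refine Finset.sum_le_sum_of_subset_of_nonneg ?_
        (fun u _ _ ↦ Finset.sum_nonneg fun v _ ↦ hr u v)
      intro x hx
      simp only [Finset.mem_insert, Finset.mem_singleton] at hx
      rw [Finset.mem_range]
      omega
    rw [Finset.sum_pair (by omega)] at h1
    have h2 := hrow j (j + m) (by omega)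
    have h3 := hrow N (N + 1) (by omega)
    linarith
  have hline : ∀ d j, j + d = N → 0 < d → M j →
      M (j + 1) ∧ C j = a - r j (j + 1) + C (j + 1) := by
    intro d
    induction d using Nat.strong_induction_on with
    | _ d ih =>
    intro j hjd hd hMj
    obtain ⟨v, hE, hMv, hle, hC, hopt⟩ := hmin j (by omega) hMj
    obtain ⟨rfl, -⟩ | ⟨rfl, hjm⟩ := hE
    · rw [jumpCost_line (by omega)] at hC
      exact ⟨hMv, hC⟩
    exfalso
    have hrj := hjump j hjm
    rw [jumpCost_jump hm, hmm] at hle hopt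
    have hback : ∀ e i, i + e = j + m → j < i → M i ∧ C i ≤ e * a + C (j + m) := by
      intro e
      induction e with
      | zero =>
        rintro i hi -
        obtain rfl : i = j + m := by omega
        exact ⟨hMv, by simp⟩
      | succ e ihe =>
        intro i hi hji
        obtain ⟨hM1, hC1⟩ := ihe (i + 1) (by omega) (by omega)
        have hea : e * a ≤ m * a := by
          have : (e : ℝ) ≤ m := by exact_mod_cast (by omega : e ≤ m)
          gcongr
        have hMi : M i := by
          refine (hiff i (by omega)).2 ⟨i + 1, Or.inl ⟨rfl, by omega⟩, hM1, ?_⟩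
          rw [jumpCost_line (by omega)]
          have := hr i (i + 1)
          linarith
        obtain ⟨-, hCi⟩ := ih (N - i) (by omega) i (by omega) (by omega) hMi
        refine ⟨hMi, ?_⟩
        have := hr i (i + 1)
        push_cast
        linarith
    obtain ⟨hM1, hC1⟩ := hback (m - 1) (j + 1) (by omega) (by omega)
    have hea : ((m - 1 : ℕ) : ℝ) * a ≤ m * a := by
      have : ((m - 1 : ℕ) : ℝ) ≤ m := by exact_mod_cast Nat.sub_le m 1
      gcongr
    have h0 := hr j (j + 1)
    have hle1 : m * jumpCost K m N j (j + 1) - r j (j + 1) + C (j + 1) ≤ 0 := by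
      rw [jumpCost_line (by omega)]
      linarith
    have := hopt (j + 1) (Or.inl ⟨rfl, by omega⟩) hM1 hle1
    rw [jumpCost_line (by omega)] at this
    linarith
  have hpath : ∀ j ≤ N, M j ∧ C 0 = j * a - ∑ i ∈ Finset.range j, r i (i + 1) + C j := by
    intro j
    induction j with
    | zero => exact fun _ ↦ ⟨hMs, by simp⟩
    | succ j ihj =>
      intro hj
      obtain ⟨hMj, hCj⟩ := ihj (by omega)
      obtain ⟨hM1, hC1⟩ := hline (N - j) j (by omega) (by omega) hMj
      refine ⟨hM1, ?_⟩
      rw [Finset.sum_range_succ]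
      push_cast
      linarith
  have hC0 : C 0 ≤ 0 := by
    obtain ⟨v, -, -, hle, hC, -⟩ := hmin 0 (Nat.zero_le N) hMs
    have h1 : (1 : ℝ) ≤ m := by exact_mod_cast (by omega : 1 ≤ m)
    have := le_mul_of_one_le_left (jumpCost_nonneg K m N 0 v) h1
    linarith
  have hCN : -r N (N + 1) ≤ C N := by
    obtain ⟨v, hE, -, -, hC, -⟩ := hmin N le_rfl hMN
    obtain rfl : v = N + 1 := by rcases hE with hE | hE <;> omega
    have := jumpCost_nonneg K m N N (N + 1)
    linarith
  have hsum : ∑ i ∈ Finset.range (N + 1), r i (i + 1) ≤ P :=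
    (Finset.sum_le_sum fun i hi ↦
      hrow i (i + 1) (by have := Finset.mem_range.1 hi; omega)).trans
      (Finset.sum_le_sum_of_subset_of_nonneg (Finset.range_mono (by omega))
        fun u _ _ ↦ Finset.sum_nonneg fun v _ ↦ hr u v)
  rw [Finset.sum_range_succ] at hsum
  have hNa : N * a = 2 := by
    rw [hN, ha]
    push_cast
    field_simp
  have := (hpath N le_rfl).2
  have : 0 ≤ 2 / (K : ℝ) := by positivity
  linarith

lemma exists_fin_iff {n : ℕ} {p : ℕ → Prop} (q : Fin n → Prop) (hpq : ∀ v : Fin n, q v ↔ p v)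
    (hlt : ∀ v, p v → v < n) : (∃ v, q v) ↔ ∃ v, p v :=
  ⟨fun ⟨v, hv⟩ ↦ ⟨v, (hpq v).1 hv⟩, fun ⟨v, hv⟩ ↦ ⟨⟨v, hlt v hv⟩, (hpq _).2 hv⟩⟩

lemma JumpEdge.lt {m N u v : ℕ} (h : JumpEdge m N u v) : v < N + 2 := by
  rcases h with h | h <;> omega

/-- Rewarding every line edge by its perceived cost motivates all nodes. -/
lemma internalRewardSpec_line {K m N : ℕ} (hm : 2 ≤ m) :
    InternalRewardSpec (jumpInstance K m N hm) m
      (fun u v ↦ if (v : ℕ) = u + 1 then m * jumpCost K m N u v else 0) (fun _ ↦ True)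
      (fun u ↦ if (u : ℕ) = N + 1 then 0
        else -((m - 1) * (((N : ℝ) - u) * (1 / (K * m)) + 1 / m))) := by
  have hm0 : (0 : ℝ) < m := by exact_mod_cast (by omega : 0 < m)
  have hm1 : (1 : ℝ) < m := by exact_mod_cast (by omega : 1 < m)
  have hm1' : (0 : ℝ) ≤ m - 1 := by linarith
  have ha : (0 : ℝ) ≤ 1 / (K * m) := by positivity
  have hinv : (0 : ℝ) < 1 / m := by positivity
  have hCle : ∀ v : ℕ, v < N + 2 → (if v = N + 1 then (0 : ℝ)
      else -((m - 1) * (((N : ℝ) - v) * (1 / (K * m)) + 1 / m))) ≤ 0 := by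
    intro v hv
    split_ifs with h
    · rfl
    · have : (0 : ℝ) ≤ N - v := sub_nonneg.2 (by exact_mod_cast (by omega : v ≤ N))
      exact neg_nonpos.2 (by positivity)
  have hlast : ∀ u : Fin (N + 2), u ≠ Fin.last (N + 1) → (u : ℕ) ≤ N := fun u hu ↦ by
    have : (u : ℕ) ≠ N + 1 := fun h ↦ hu (Fin.ext h)
    omega
  have hstep : ∀ u : Fin (N + 2), u ≠ Fin.last (N + 1) →
      ∃ v : Fin (N + 2), (v : ℕ) = u + 1 ∧ JumpEdge m N u v := fun u hu ↦
    ⟨⟨u + 1, by have := hlast u hu; omega⟩, rfl, Or.inl ⟨rfl, hlast u hu⟩⟩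
  refine ⟨trivial, by simp [jumpInstance], fun u hu ↦ ?_, fun u hu _ ↦ ?_⟩
  · obtain ⟨v, hv, hE⟩ := hstep u hu
    refine iff_of_true trivial ⟨v, hE, trivial, ?_⟩
    have := hCle v v.isLt
    simp only [hv, if_true, jumpInstance, sub_self, zero_add] at this ⊢
    exact this
  · obtain ⟨v, hv, hE⟩ := hstep u hu
    have huN := hlast u hu
    have hvle := hCle v v.isLt
    refine ⟨v, hE, trivial, ?_, ?_, ?_⟩
    · simp only [hv, if_true, jumpInstance, sub_self, zero_add] at hvle ⊢
      exact hvle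
    · simp only [hv, if_true, jumpInstance]
      rw [if_neg (by omega)]
      obtain h | h := huN.eq_or_lt
      · rw [if_pos (by omega), h, jumpCost_last]
        ring
      · rw [if_neg (by omega), jumpCost_line h]
        push_cast
        ring
    · intro w hw _ _
      simp only [hv, if_true, jumpInstance, sub_self, zero_add]
      obtain ⟨hw, -⟩ | ⟨hw, hwN⟩ := hw
      · simp [hw]
      · rw [if_neg (by omega), if_neg (by omega), if_neg (by omega), hw, jumpCost_jump hm]
        have h1 : ((m : ℝ) - 1) * (((N : ℝ) - (u + m : ℕ)) * (1 / (K * m)) + 1 / m)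
            ≤ (m - 1) * (((N : ℝ) - (u + 1 : ℕ)) * (1 / (K * m)) + 1 / m) := by
          gcongr
          omega
        have : (0 : ℝ) ≤ m * (1 / m) := by positivity
        linarith

lemma two_sub_le_Rint {K m N : ℕ} (hK : 1 ≤ K) (hm : 2 ≤ m) (hN : N = 2 * K * m) :
    2 - 2 / (K : ℝ) ≤ Rint (jumpInstance K m N hm) m := by
  refine le_csInf ⟨_, _, fun u v ↦ ?_, fun u v hE ↦ ?_, rfl, _, _, internalRewardSpec_line hm,
    trivial⟩ ?_
  · have := jumpCost_nonneg K m N u v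
    split_ifs <;> positivity
  · refine if_neg fun h ↦ hE (Or.inl ⟨h, ?_⟩)
    omega
  rintro _ ⟨r, hr, -, rfl, M, C, ⟨-, hCt, hiff, hmin⟩, hMs⟩
  have hcast : ∀ v, v < N + 2 → ((Fin.ofNat (N + 2) v : Fin (N + 2)) : ℕ) = v := fun v hv ↦
    Nat.mod_eq_of_lt hv
  have hself : ∀ v : Fin (N + 2), Fin.ofNat (N + 2) v = v := fun v ↦
    Fin.ext (hcast v v.isLt)
  have hne : ∀ u ≤ N, Fin.ofNat (N + 2) u ≠ Fin.last (N + 1) := fun u hu h ↦ by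
    have := congrArg Fin.val h
    rw [hcast u (by omega), Fin.val_last] at this
    omega
  have hlast : Fin.ofNat (N + 2) (N + 1) = Fin.last (N + 1) := hself (Fin.last (N + 1))
  have key := two_sub_le_sum_reward hK hm hN
    (r := fun u v ↦ r (Fin.ofNat _ u) (Fin.ofNat _ v))
    (M := fun u ↦ M (Fin.ofNat _ u)) (C := fun u ↦ C (Fin.ofNat _ u))
    (fun _ _ ↦ hr _ _) (by rw [hlast]; exact hCt)
    (fun u hu ↦ ?_) (fun u hu hMu ↦ ?_) hMs
  · simpa only [Finset.sum_range, hself] using key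
  · refine (hiff _ (hne u hu)).trans (exists_fin_iff _ (fun v ↦ ?_) fun v hv ↦ hv.1.lt)
    simp only [jumpInstance, hself, hcast u (by omega)]
  · obtain ⟨v, h1, h2, h3, h4, h5⟩ := hmin _ (hne u hu) hMu
    simp only [jumpInstance, hcast u (show u < N + 2 by omega)] at h1 h3 h4 h5
    refine ⟨v, h1, ?_, ?_, ?_, fun w hw hMw hle ↦ ?_⟩
    · simpa only [hself] using h2
    · simpa only [hself] using h3
    · simpa only [hself] using h4
    · have := h5 (Fin.ofNat _ w)
      rw [hcast w hw.lt] at this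
      simpa only [hself] using this hw hMw hle

/-- Keeping only the jumps between multiples of `m` and the last line edge, the reward
`1 + N / m ^ 2` suffices. -/
lemma traversableOn_jumps {K m N : ℕ} (hm : 2 ≤ m) (hN : m ∣ N) :
    TraversableOn (jumpInstance K m N hm)
      (fun u v ↦ m ∣ (u : ℕ) ∧ JumpEdge m N u v ∧ ((v : ℕ) = u + 1 → (u : ℕ) = N))
      m (1 + N / (m : ℝ) ^ 2) := by
  have hm0 : (0 : ℝ) < m := by exact_mod_cast (by omega : 0 < m)
  have hmm : (m : ℝ) * (1 / m) = 1 := by field_simp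
  have hlast : ∀ u : Fin (N + 2), u ≠ Fin.last (N + 1) → (u : ℕ) ≤ N := fun u hu ↦ by
    have : (u : ℕ) ≠ N + 1 := fun h ↦ hu (Fin.ext h)
    omega
  let C : Fin (N + 2) → ℝ := fun u ↦
    if (u : ℕ) = N + 1 then 0 else ((N : ℝ) - u) / (m : ℝ) ^ 2 + 1 / m
  have hedge : ∀ u v : Fin (N + 2), m ∣ (u : ℕ) → JumpEdge m N u v →
      ((v : ℕ) = u + 1 → (u : ℕ) = N) → jumpCost K m N u v = 1 / m ∧
      C u = 1 / m + C v ∧ (m ∣ (v : ℕ) ∨ (v : ℕ) = N + 1) := by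
    intro u v hu hE hv
    obtain ⟨hv', -⟩ | ⟨hv', hvN⟩ := hE
    · have huN := hv hv'
      refine ⟨by rw [hv', huN, jumpCost_last], ?_, Or.inr (by omega)⟩
      simp only [C]
      rw [if_neg (by omega), if_pos (by omega), huN]
      ring
    · refine ⟨by rw [hv', jumpCost_jump hm], ?_, Or.inl (hv' ▸ Nat.dvd_add hu dvd_rfl)⟩
      simp only [C]
      rw [if_neg (by omega), if_neg (by omega), hv']
      push_cast
      field_simp
      ring
  have hle : ∀ u : Fin (N + 2), (u : ℕ) ≤ N → C u - 1 / m ≤ N / (m : ℝ) ^ 2 := by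
    intro u hu
    simp only [C]
    rw [if_neg (by omega), add_sub_cancel_right]
    gcongr
    simp
  have hex : ∀ u : Fin (N + 2), u ≠ Fin.last (N + 1) → m ∣ (u : ℕ) → ∃ v : Fin (N + 2),
      JumpEdge m N u v ∧ ((v : ℕ) = u + 1 → (u : ℕ) = N) := by
    intro u hu hdvd
    obtain huN | huN := (hlast u hu).eq_or_lt
    · exact ⟨Fin.last (N + 1), Or.inl ⟨by simp [huN], huN.le⟩, fun _ ↦ huN⟩
    · have : m ≤ N - u := Nat.le_of_dvd (by omega) (Nat.dvd_sub hN hdvd)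
      exact ⟨⟨u + m, by omega⟩, Or.inr ⟨rfl, by simp only; omega⟩, fun h ↦ by simp at h; omega⟩
  refine ⟨fun u ↦ m ∣ (u : ℕ) ∨ (u : ℕ) = N + 1, C, ⟨Or.inr rfl, by simp [C, jumpInstance],
    fun u hu ↦ ⟨fun hMu ↦ ?_, fun ⟨v, hE, _⟩ ↦ Or.inl hE.1⟩, fun u hu hMu ↦ ?_⟩,
    Or.inl (dvd_zero m)⟩
  all_goals
    have huN := hlast u hu
    have hdvd : m ∣ (u : ℕ) := hMu.resolve_right (by omega)
    obtain ⟨v, hE, hv⟩ := hex u hu hdvd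
    obtain ⟨h1, h2, h3⟩ := hedge u v hdvd hE hv
    have h4 := hle u huN
    have h5 : m * (jumpInstance K m N hm).c u v + C v ≤ 1 + N / (m : ℝ) ^ 2 := by
      simp only [jumpInstance]
      rw [h1]
      linarith
  · exact ⟨v, ⟨hdvd, hE, hv⟩, h3, h5⟩
  · refine ⟨v, ⟨hdvd, hE, hv⟩, h3, h5, by simp only [jumpInstance]; rw [h1, h2], ?_⟩
    rintro w ⟨-, hEw, hw⟩ - -
    obtain ⟨h1', h2', -⟩ := hedge u w hdvd hEw hw
    simp only [jumpInstance]
    rw [h1, h1']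
    linarith

lemma Rdel_le {K m N : ℕ} (hm : 2 ≤ m) (hN : m ∣ N) :
    Rdel (jumpInstance K m N hm) m ≤ 1 + N / (m : ℝ) ^ 2 :=
  csInf_le ⟨0, fun _ h ↦ h.1⟩ ⟨by positivity, _, fun _ _ h ↦ h.2.1, traversableOn_jumps hm hN⟩

/-- The last edge alone forces `R_d` to be at least `1`. -/
lemma one_le_Rdel {K m N : ℕ} (hm : 2 ≤ m) (hN : m ∣ N) :
    1 ≤ Rdel (jumpInstance K m N hm) m := by
  have hm0 : (0 : ℝ) < m := by exact_mod_cast (by omega : 0 < m)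
  refine le_csInf ⟨_, by positivity, _, fun _ _ h ↦ h.2.1, traversableOn_jumps hm hN⟩ ?_
  rintro R ⟨-, E', hE', M, C, ⟨-, hCt, hiff, -⟩, hMs⟩
  have hne : ∀ u (hu : u ≤ N), (⟨u, by omega⟩ : Fin (N + 2)) ≠ Fin.last (N + 1) :=
    fun u hu h ↦ by
      have := congrArg Fin.val h
      simp only [Fin.val_last] at this
      omega
  obtain ⟨hN', hMN⟩ := of_forall_exists_jumpEdge (M := fun u ↦ ∃ h : u < N + 2, M ⟨u, h⟩) hm
    (fun u hu ⟨_, hMu⟩ ↦ by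
      obtain ⟨v, hv, hMv, -⟩ := (hiff _ (hne u hu)).1 hMu
      exact ⟨v, hE' _ _ hv, v.isLt, hMv⟩) (Nat.zero_le N) ⟨by omega, hMs⟩
  obtain ⟨v, hv, -, hle⟩ := (hiff _ (hne N le_rfl)).1 hMN
  have hvN : (v : ℕ) = N + 1 := by
    rcases hE' _ _ hv with h | h <;> simp only at h <;> omega
  obtain rfl : v = Fin.last (N + 1) := Fin.ext hvN
  have hCt' : C (Fin.last (N + 1)) = 0 := hCt
  rw [hCt'] at hle
  simp only [jumpInstance, Fin.val_last, jumpCost_last] at hle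
  rwa [add_zero, mul_one_div_cancel hm0.ne'] at hle

/-- The ratio `2` is approached by instances with positive `R_d`. -/
lemma exists_Rdel_pos_and_le_Rint (ε : ℝ) (hε : 0 < ε) :
    ∃ (n : ℕ) (G : PlanningInstance n) (b : ℝ),
      1 < b ∧ 0 < Rdel G b ∧ (2 - ε) * Rdel G b ≤ Rint G b := by
  obtain ⟨K, hK⟩ := exists_nat_gt (max 1 (4 / ε))
  have hK1 : (1 : ℝ) < K := (le_max_left _ _).trans_lt hK
  have hK1' : 1 < K := by exact_mod_cast hK1
  have hKε : 4 / (K : ℝ) < ε := by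
    rw [div_lt_comm₀ (by positivity) hε]
    exact (le_max_right _ _).trans_lt hK
  have hm : 2 ≤ 2 * K ^ 2 := by nlinarith
  have hdvd : 2 * K ^ 2 ∣ 2 * K * (2 * K ^ 2) := dvd_mul_left _ _
  have h1 := one_le_Rdel (K := K) hm hdvd
  have h2 := Rdel_le (K := K) hm hdvd
  have h3 := two_sub_le_Rint hK1'.le hm rfl
  refine ⟨_, _, ((2 * K ^ 2 : ℕ) : ℝ), by exact_mod_cast hm, by linarith, ?_⟩
  · refine le_trans ?_ h3
    have h4 : ((2 * K * (2 * K ^ 2) : ℕ) : ℝ) / ((2 * K ^ 2 : ℕ) : ℝ) ^ 2 = 1 / K := by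
      push_cast
      field_simp
    rw [h4] at h2
    have h5 : (4 : ℝ) / K = 4 * (1 / K) := by ring
    have h6 : (2 : ℝ) / K = 2 * (1 / K) := by ring
    have := mul_le_mul_of_nonneg_left h1 hε.le
    linarith

/-- Edge deletion can be strictly more powerful than
internal rewards by a factor approaching `2`: for every `ε > 0` there is a
planning instance and a bias `b > 1` with `R_i(G) ≥ (2 - ε) · R_d(G)`. -/
theorem internal_vs_deletion_ratio_two (ε : ℝ) (hε : 0 < ε) :
    ∃ (n : ℕ) (G : PlanningInstance n) (b : ℝ),
      1 < b ∧ (2 - ε) * Rdel G b ≤ Rint G b := by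
  obtain ⟨n, G, b, hb, -, h⟩ := exists_Rdel_pos_and_le_Rint ε hε
  exact ⟨n, G, b, hb, h⟩
end

section
/- In the reward-seeking model with bias b > 1, the naive agent's reward ratio is at most b: for every node u, b · R_n(u) ≥ R_o(u); in particular the naive agent starting at s collects at least a 1/b fraction of the optimal reward. -/
/-- In the reward-seeking model, edge weights `G.c` are interpreted as
nonnegative rewards; `Ro u` is the maximum total reward of a path from `u`
to the target. -/
def IsOptReward {n : ℕ} (G : PlanningInstance n) (Ro : Fin n → ℝ) : Prop :=
  ∀ u, IsGreatest {x : ℝ | ∃ l, IsPathTo G.E G.t u l ∧ pathCost G.c u l = x}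
    (Ro u)

/-- `S` is a naive reward-seeking choice function with bias `b` (maximizing
`b·r(u,v) + R_o(v)` over edges `(u,v)`), and `Rn` the reward it collects. -/
structure NaiveRewardSpec {n : ℕ} (G : PlanningInstance n) (b : ℝ)
    (Ro : Fin n → ℝ) (S : Fin n → Fin n) (Rn : Fin n → ℝ) : Prop where
  r_t : Rn G.t = 0
  edge : ∀ u, u ≠ G.t → G.E u (S u)
  max : ∀ u, u ≠ G.t → ∀ v, G.E u v →
    b * G.c u v + Ro v ≤ b * G.c u (S u) + Ro (S u)
  val : ∀ u, u ≠ G.t → Rn u = G.c u (S u) + Rn (S u)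

theorem IsPathTo.le {n : ℕ} {E : Fin n → Fin n → Prop} {t : Fin n}
    (hE : ∀ u v, E u v → u < v) :
    ∀ {l : List (Fin n)} {u : Fin n}, IsPathTo E t u l → u ≤ t
  | [], _, h => le_of_eq h
  | _ :: _, _, h => (hE _ _ h.1).le.trans (h.2.le hE)

/-- In the reward-seeking model with bias `b > 1`, the naive
agent's reward ratio is at most `b`: `b · R_n(u) ≥ R_o(u)` at every node; in
particular the naive agent starting at `s` collects at least a `1/b` fraction
of the optimal reward. -/
theorem naive_reward_ratio {n : ℕ} (G : PlanningInstance n) (b : ℝ)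
    (hb : 1 < b) (Ro : Fin n → ℝ) (hRo : IsOptReward G Ro)
    (S : Fin n → Fin n) (Rn : Fin n → ℝ)
    (hN : NaiveRewardSpec G b Ro S Rn) :
    (∀ u, Ro u ≤ b * Rn u) ∧ Ro G.s / b ≤ Rn G.s := by
  have key : ∀ u, Ro u ≤ b * Rn u := by
    intro u
    induction u using WellFoundedGT.induction with
    | ind u ih =>
      obtain ⟨l, hl, hval⟩ := (hRo u).1
      by_cases hu : u = G.t
      · subst hu
        cases l with
        | nil => simp [← hval, pathCost, hN.r_t]
        | cons v l =>
          exact absurd (hl.2.le G.edge_lt) (not_le.mpr (G.edge_lt _ _ hl.1))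
      · cases l with
        | nil => exact absurd hl hu
        | cons v l =>
          have hopt : pathCost G.c v l ≤ Ro v := (hRo v).2 ⟨l, hl.2, rfl⟩
          have hbias : G.c u v ≤ b * G.c u v :=
            le_mul_of_one_le_left (G.c_nonneg u v hl.1) hb.le
          have hmax := hN.max u hu v hl.1
          have hnext := ih (S u) (G.edge_lt _ _ (hN.edge u hu))
          rw [hN.val u hu, mul_add]
          simp only [pathCost] at hval
          linarith
  exact ⟨key, (div_le_iff₀' (by linarith)).mpr (key G.s)⟩
end

section
/- For a reward-seeking sophisticated agent that may first add zero-reward edges: in every reward-seeking instance on n nodes with bias b > 1, the maximum reward R_z achievable by the sophisticated agent over all acyclic graphs obtained from G by adding edges of reward 0 satisfies b·n · R_z ≥ R_o(s); i.e., adding zero-reward edges guarantees a reward ratio of at most b·n. -/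
/-- A sophisticated reward-seeking agent over the edge relation `E'` with
edge rewards `r` and bias `b`: at each `u ≠ t` the successor `S u` maximizes
`b·r(u,v) + Rs v`, and `Rs` is the collected reward. -/
structure SophRewardSpecOn {n : ℕ} (t : Fin n) (E' : Fin n → Fin n → Prop)
    (r : Fin n → Fin n → ℝ) (b : ℝ) (S : Fin n → Fin n)
    (Rs : Fin n → ℝ) : Prop where
  r_t : Rs t = 0
  edge : ∀ u, u ≠ t → E' u (S u)
  max : ∀ u, u ≠ t → ∀ v, E' u v →
    b * r u v + Rs v ≤ b * r u (S u) + Rs (S u)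
  val : ∀ u, u ≠ t → Rs u = r u (S u) + Rs (S u)

/-- `R_z`: the maximum reward the sophisticated agent can collect from `s`
over all acyclic graphs obtained from `G` by adding edges of reward `0`
(keeping `s`, `t`, all original edges and their rewards). -/
noncomputable def Rzero {n : ℕ} (G : PlanningInstance n) (b : ℝ) : ℝ :=
  sSup {x : ℝ | ∃ (E' : Fin n → Fin n → Prop) (r : Fin n → Fin n → ℝ),
    (∀ u v, G.E u v → E' u v) ∧
    (∃ ord : Fin n → ℕ, ∀ u v, E' u v → ord u < ord v) ∧
    (∀ u v, G.E u v → r u v = G.c u v) ∧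
    (∀ u v, E' u v → ¬ G.E u v → r u v = 0) ∧
    (∀ u v, 0 ≤ r u v) ∧
    ∃ S Rs, SophRewardSpecOn G.t E' r b S Rs ∧ Rs G.s = x}

theorem IsPathTo.val_add_length_le {n : ℕ} {E : Fin n → Fin n → Prop} {t : Fin n}
    (hE : ∀ u v, E u v → u < v) (l : List (Fin n)) (u : Fin n) (h : IsPathTo E t u l) :
    u.val + l.length ≤ t.val := by
  induction l generalizing u with
  | nil => simp only [IsPathTo] at h; simp [h]
  | cons v l ih =>
    have h1 : u.val < v.val := hE u v h.1
    have h2 := ih v h.2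
    simp only [List.length_cons]
    omega

theorem IsPathTo.pathCost_le {n : ℕ} {E : Fin n → Fin n → Prop} {t : Fin n}
    {c : Fin n → Fin n → ℝ} {m : ℝ} (hE : ∀ u v, E u v → u < v) (l : List (Fin n)) (u : Fin n)
    (h : IsPathTo E t u l) (hm : ∀ x y, u ≤ x → E x y → c x y ≤ m) :
    pathCost c u l ≤ l.length * m := by
  induction l generalizing u with
  | nil => simp [pathCost]
  | cons v l ih =>
    have h1 := hm u v le_rfl h.1
    have h2 := ih v h.2 fun x y hx => hm x y ((hE u v h.1).le.trans hx)
    simp only [pathCost, List.length_cons, Nat.cast_add, Nat.cast_one]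
    linarith

/-- Induction from the sinks of an acyclic relation backwards. -/
theorem ord_induction {n : ℕ} (ord : Fin n → ℕ) {P : Fin n → Prop}
    (h : ∀ u, (∀ v, ord u < ord v → P v) → P u) (u : Fin n) : P u := by
  have : IsTrans (Fin n) fun v u => ord u < ord v := ⟨fun _ _ _ h1 h2 => h2.trans h1⟩
  have : Std.Irrefl fun v u : Fin n => ord u < ord v := ⟨fun _ => lt_irrefl _⟩
  exact (Finite.wellFounded_of_trans_of_irrefl fun v u : Fin n => ord u < ord v).induction u h

namespace SophRewardSpecOn

variable {n : ℕ} {t : Fin n} {E : Fin n → Fin n → Prop} {r : Fin n → Fin n → ℝ} {b : ℝ}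
  {S : Fin n → Fin n} {Rs : Fin n → ℝ}

theorem nonneg (h : SophRewardSpecOn t E r b S Rs) (ord : Fin n → ℕ)
    (hord : ∀ u v, E u v → ord u < ord v) (hr : ∀ u v, 0 ≤ r u v) (u : Fin n) : 0 ≤ Rs u := by
  induction u using ord_induction ord with
  | h u ih =>
    by_cases hu : u = t
    · rw [hu, h.r_t]
    · rw [h.val u hu]
      exact add_nonneg (hr _ _) (ih _ (hord _ _ (h.edge u hu)))

theorem le_mul_card (h : SophRewardSpecOn t E r b S Rs) (ord : Fin n → ℕ)
    (hord : ∀ u v, E u v → ord u < ord v) {C : ℝ} (hC : 0 ≤ C) (hr : ∀ u v, E u v → r u v ≤ C)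
    (u : Fin n) : Rs u ≤ C * (Finset.univ.filter fun w => ord u ≤ ord w).card := by
  induction u using ord_induction ord with
  | h u ih =>
    by_cases hu : u = t
    · rw [hu, h.r_t]
      positivity
    · have he := h.edge u hu
      have hlt := hord _ _ he
      have hcard : (Finset.univ.filter fun w => ord (S u) ≤ ord w).card + 1 ≤
          (Finset.univ.filter fun w => ord u ≤ ord w).card := by
        apply Finset.card_lt_card
        rw [Finset.ssubset_iff_of_subset]
        · exact ⟨u, by simp, by simpa using hlt⟩
        · intro w hw
          simp only [Finset.mem_filter, Finset.mem_univ, true_and] at hw ⊢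
          exact hlt.le.trans hw
      have hcard' : ((Finset.univ.filter fun w => ord (S u) ≤ ord w).card : ℝ) + 1 ≤
          (Finset.univ.filter fun w => ord u ≤ ord w).card := by exact_mod_cast hcard
      have h1 := ih _ hlt
      have h2 := hr _ _ he
      have h3 := mul_le_mul_of_nonneg_left hcard' hC
      rw [h.val u hu]
      linarith

theorem edge_value_le (h : SophRewardSpecOn t E r b S Rs) (hb : 1 ≤ b) (hR : ∀ u, 0 ≤ Rs u)
    {u v : Fin n} (hu : u ≠ t) (huv : E u v) : b * r u v + Rs v ≤ b * Rs u := by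
  have h1 := h.max u hu v huv
  have h2 := le_mul_of_one_le_left (hR (S u)) hb
  rw [h.val u hu]
  linarith

/-- A sophisticated agent exists on every topologically ordered graph without dead ends. -/
theorem exists_of_lt (t : Fin n) (r : Fin n → Fin n → ℝ) (b : ℝ)
    (hE : ∀ u v, E u v → u < v) (hout : ∀ u, u ≠ t → ∃ v, E u v) :
    ∃ S Rs, SophRewardSpecOn t E r b S Rs := by
  classical
  have hmax : ∀ (u : Fin n) (f : Fin n → ℝ), ∃ v, u ≠ t →
      E u v ∧ ∀ w, E u w → f w ≤ f v := by
    intro u f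
    by_cases hu : u = t
    · exact ⟨u, fun h => absurd hu h⟩
    · obtain ⟨v₀, hv₀⟩ := hout u hu
      obtain ⟨v, hv, hle⟩ := Finset.exists_max_image (Finset.univ.filter fun w => E u w) f
        ⟨v₀, by simpa using hv₀⟩
      exact ⟨v, fun _ => ⟨by simpa using hv, fun w hw => hle w (by simpa using hw)⟩⟩
  choose a ha using hmax
  let ext (u : Fin n) (rec : ∀ v, v > u → ℝ) (w : Fin n) : ℝ := if h : w > u then rec w h else 0
  let F (u : Fin n) (rec : ∀ v, v > u → ℝ) : ℝ :=
    if u = t then 0 else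
      r u (a u fun w => b * r u w + ext u rec w) +
        ext u rec (a u fun w => b * r u w + ext u rec w)
  have wf : WellFounded fun v u : Fin n => v > u := wellFounded_gt
  let Rs : Fin n → ℝ := wf.fix F
  let f (u w : Fin n) : ℝ := b * r u w + ext u (fun v _ => Rs v) w
  have hfix (u : Fin n) : Rs u = F u fun v _ => Rs v := wf.fix_eq F u
  have hext {u w : Fin n} (h : E u w) : ext u (fun v _ => Rs v) w = Rs w := dif_pos (hE u w h)
  refine ⟨fun u => a u (f u), Rs, ⟨?_, fun u hu => (ha u (f u) hu).1, ?_, ?_⟩⟩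
  · rw [hfix]
    exact if_pos rfl
  · intro u hu v huv
    have h := (ha u (f u) hu).2 v huv
    simp only [f] at h
    rwa [hext huv, hext (ha u (f u) hu).1] at h
  · intro u hu
    rw [hfix]
    refine (if_neg hu).trans ?_
    change r u (a u (f u)) + ext u (fun v _ => Rs v) (a u (f u)) = _
    rw [hext (ha u (f u) hu).1]

end SophRewardSpecOn

theorem bddAbove_Rzero {n : ℕ} (G : PlanningInstance n) (b : ℝ) :
    BddAbove {x : ℝ | ∃ (E' : Fin n → Fin n → Prop) (r : Fin n → Fin n → ℝ),
      (∀ u v, G.E u v → E' u v) ∧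
      (∃ ord : Fin n → ℕ, ∀ u v, E' u v → ord u < ord v) ∧
      (∀ u v, G.E u v → r u v = G.c u v) ∧
      (∀ u v, E' u v → ¬ G.E u v → r u v = 0) ∧
      (∀ u v, 0 ≤ r u v) ∧
      ∃ S Rs, SophRewardSpecOn G.t E' r b S Rs ∧ Rs G.s = x} := by
  have hC : 0 ≤ ∑ u, ∑ v, |G.c u v| :=
    Finset.sum_nonneg fun _ _ => Finset.sum_nonneg fun _ _ => abs_nonneg _
  refine ⟨(∑ u, ∑ v, |G.c u v|) * n, ?_⟩
  rintro x ⟨E', r, -, ⟨ord, hord⟩, hr, hr0, -, S, Rs, h, rfl⟩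
  have hle (u v : Fin n) (huv : E' u v) : r u v ≤ ∑ u, ∑ v, |G.c u v| := by
    by_cases hG : G.E u v
    · rw [hr u v hG]
      calc G.c u v ≤ |G.c u v| := le_abs_self _
        _ ≤ ∑ v, |G.c u v| :=
          Finset.single_le_sum (f := fun v => |G.c u v|) (fun _ _ => abs_nonneg _)
            (Finset.mem_univ v)
        _ ≤ _ := Finset.single_le_sum (f := fun u => ∑ v, |G.c u v|)
            (fun _ _ => Finset.sum_nonneg fun _ _ => abs_nonneg _) (Finset.mem_univ u)
    · rwa [hr0 u v huv hG]
  refine (h.le_mul_card ord hord hC hle G.s).trans (mul_le_mul_of_nonneg_left ?_ hC)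
  exact_mod_cast (Finset.card_le_univ _).trans_eq (Fintype.card_fin n)

theorem Rzero_nonneg {n : ℕ} (G : PlanningInstance n) (b : ℝ) : 0 ≤ Rzero G b := by
  apply Real.sSup_nonneg
  rintro x ⟨E', r, -, ⟨ord, hord⟩, -, -, hr, S, Rs, h, rfl⟩
  exact h.nonneg ord hord hr G.s

/-- Adding a single zero-reward edge from `s` to the tail of an edge secures a `1 / b` fraction
of the reward of that edge. -/
theorem edge_reward_le_mul_Rzero {n : ℕ} (G : PlanningInstance n) {b : ℝ} (hb : 1 ≤ b)
    {x y : Fin n} (hsx : G.s ≤ x) (hxy : G.E x y) : G.c x y ≤ b * Rzero G b := by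
  classical
  have hb0 : 0 ≤ b := zero_le_one.trans hb
  let E' (u v : Fin n) : Prop := G.E u v ∨ (u = G.s ∧ v = x ∧ u < v)
  let r (u v : Fin n) : ℝ := if G.E u v then G.c u v else 0
  have hE' (u v : Fin n) (h : E' u v) : u < v := h.elim (G.edge_lt u v) fun h => h.2.2
  have hr (u v : Fin n) : 0 ≤ r u v := by
    by_cases h : G.E u v
    · simpa [r, h] using G.c_nonneg u v h
    · simp [r, h]
  have hrxy : r x y = G.c x y := if_pos hxy
  obtain ⟨S, Rs, h⟩ := SophRewardSpecOn.exists_of_lt (E := E') G.t r b hE' fun u hu =>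
    (G.exists_edge hu).imp fun _ => Or.inl
  have hle : Rs G.s ≤ Rzero G b :=
    le_csSup (bddAbove_Rzero G b) ⟨E', r, fun _ _ => Or.inl, ⟨Fin.val, hE'⟩,
      fun _ _ h => if_pos h, fun _ _ _ h => if_neg h, hr, S, Rs, h, rfl⟩
  have hR := h.nonneg Fin.val hE' hr
  have hlt_t {u v : Fin n} (huv : u < v) : u ≠ G.t := by
    obtain ⟨l, hl⟩ := G.reach v
    have h1 := IsPathTo.val_add_length_le G.edge_lt l v hl
    rintro rfl
    have h2 : G.t.val < v.val := huv
    omega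
  have hx := h.edge_value_le hb hR (hlt_t (G.edge_lt x y hxy)) (Or.inl hxy)
  rw [hrxy] at hx
  have hcx : G.c x y ≤ Rs x :=
    le_of_mul_le_mul_left (by linarith [hR y]) (zero_lt_one.trans_le hb)
  have hxs : Rs x ≤ b * Rs G.s := by
    rcases hsx.eq_or_lt with heq | hlt
    · rw [heq]
      exact le_mul_of_one_le_left (hR x) hb
    · have := h.edge_value_le hb hR (hlt_t hlt) (Or.inr ⟨rfl, rfl, hlt⟩)
      linarith [mul_nonneg hb0 (hr G.s x)]
  exact hcx.trans (hxs.trans (mul_le_mul_of_nonneg_left hle hb0))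

/-- Adding zero-reward edges guarantees a reward ratio of at
most `b·n` for the sophisticated reward-seeking agent: in every instance on
`n` nodes with bias `b > 1`, `b · n · R_z ≥ R_o(s)`. -/
theorem zero_reward_edges_ratio {n : ℕ} (G : PlanningInstance n) (b : ℝ)
    (hb : 1 < b) (Ro : Fin n → ℝ) (hRo : IsOptReward G Ro) :
    Ro G.s ≤ b * n * Rzero G b := by
  obtain ⟨l, hl, hcost⟩ := (hRo G.s).1
  have hlen : (l.length : ℝ) ≤ n := by
    have := IsPathTo.val_add_length_le G.edge_lt l G.s hl
    exact_mod_cast (by omega : l.length ≤ n)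
  have hpos : 0 ≤ b * Rzero G b := mul_nonneg (by linarith) (Rzero_nonneg G b)
  calc Ro G.s = pathCost G.c G.s l := hcost.symm
    _ ≤ l.length * (b * Rzero G b) :=
      IsPathTo.pathCost_le G.edge_lt l G.s hl fun _ _ => edge_reward_le_mul_Rzero G hb.le
    _ ≤ n * (b * Rzero G b) := mul_le_mul_of_nonneg_right hlen hpos
    _ = b * n * Rzero G b := by ring
end
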